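/- arXiv:2407.03002 — 2 statements merged into one kernel-verified Lean document; each statement's English description precedes it below -/
import Mathlib

section
/- For every integer m ≥ 1, the rational function Q_m(v) has a pole at v = 1/m if and only if m is a perfect square, i.e. there exists k ∈ ℤ with m = k². -/
open Polynomial

noncomputable section

/-- Derivative of a rational function. -/
def ratDeriv (f : RatFunc ℚ) : RatFunc ℚ :=
  RatFunc.mk (Polynomial.derivative f.num * f.denom - f.num * Polynomial.derivative f.denom)
    (f.denom ^ 2)

namespace QP

/-- lattice points on a line with square `n` -/
def P1 (n : ℕ) : Finset ℤ := (Finset.Icc (-(n:ℤ)) n).filter (fun a => a.natAbs ^ 2 = n)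

lemma mem_P1 (n : ℕ) (a : ℤ) : a ∈ P1 n ↔ a.natAbs ^ 2 = n := by
  unfold P1
  rw [Finset.mem_filter, Finset.mem_Icc]
  refine ⟨fun h => h.2, fun h => ⟨?_, h⟩⟩
  have : a.natAbs ≤ n := by nlinarith [Nat.le_self_pow (n := 2) (by norm_num) a.natAbs]
  omega

/-- lattice points in the plane -/
def P2 (n : ℕ) : Finset (ℤ × ℤ) :=
  ((Finset.Icc (-(n:ℤ)) n) ×ˢ (Finset.Icc (-(n:ℤ)) n)).filter
    (fun p => p.1.natAbs ^ 2 + p.2.natAbs ^ 2 = n)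

lemma mem_P2 (n : ℕ) (p : ℤ × ℤ) : p ∈ P2 n ↔ p.1.natAbs ^ 2 + p.2.natAbs ^ 2 = n := by
  unfold P2
  rw [Finset.mem_filter, Finset.mem_product, Finset.mem_Icc, Finset.mem_Icc]
  refine ⟨fun h => h.2, fun h => ⟨?_, h⟩⟩
  have h1 : p.1.natAbs ≤ n := by nlinarith [Nat.le_self_pow (n := 2) (by norm_num) p.1.natAbs]
  have h2 : p.2.natAbs ≤ n := by nlinarith [Nat.le_self_pow (n := 2) (by norm_num) p.2.natAbs]
  omega

/-- weighted theta series -/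
def thetaW (f : ℕ → ℚ) : PowerSeries ℚ := PowerSeries.mk fun n => ∑ a ∈ P1 n, f (a.natAbs ^ 2)

lemma coeff_thetaW_mul (f g : ℕ → ℚ) (n : ℕ) :
    PowerSeries.coeff n (thetaW f * thetaW g)
      = ∑ p ∈ P2 n, f (p.1.natAbs ^ 2) * g (p.2.natAbs ^ 2) := by
  rw [PowerSeries.coeff_mul]
  simp only [thetaW, PowerSeries.coeff_mk, Finset.sum_mul_sum, ← Finset.sum_product']
  rw [Finset.sum_sigma']
  refine Finset.sum_bij' (fun x _ => x.2)
    (fun p _ => ⟨(p.1.natAbs ^ 2, p.2.natAbs ^ 2), p⟩) ?_ ?_ ?_ ?_ ?_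
  · rintro ⟨⟨i, j⟩, p⟩ h
    simp only [Finset.mem_sigma, Finset.HasAntidiagonal.mem_antidiagonal, Finset.mem_product, mem_P1] at h
    rw [mem_P2, h.2.1, h.2.2]; exact h.1
  · intro p h
    rw [mem_P2] at h
    simp only [Finset.mem_sigma, Finset.HasAntidiagonal.mem_antidiagonal, Finset.mem_product, mem_P1]
    exact ⟨h, trivial, trivial⟩
  · rintro ⟨⟨i, j⟩, p⟩ h
    simp only [Finset.mem_sigma, Finset.HasAntidiagonal.mem_antidiagonal, Finset.mem_product, mem_P1] at h
    obtain ⟨-, rfl, rfl⟩ := h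
    rfl
  · intro p h; rfl
  · intro p h; rfl

def th : PowerSeries ℚ := thetaW (fun _ => 1)
def ph : PowerSeries ℚ := thetaW (fun n => (-1) ^ n)

lemma coeff_thth (n : ℕ) : PowerSeries.coeff n (th * th) = ((P2 n).card : ℚ) := by
  unfold th; rw [coeff_thetaW_mul]; simp

lemma coeff_phph (n : ℕ) : PowerSeries.coeff n (ph * ph) = (-1) ^ n * ((P2 n).card : ℚ) := by
  unfold ph; rw [coeff_thetaW_mul]
  rw [Finset.sum_congr rfl (g := fun _ => (-1 : ℚ) ^ n)]
  · simp [mul_comm]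
  · intro p hp
    rw [mem_P2] at hp
    rw [← pow_add, hp]

lemma sum_P2_double (k : ℕ) (F : ℤ × ℤ → ℚ) :
    ∑ p ∈ P2 (2 * k), F p = ∑ p ∈ P2 k, F (p.1 + p.2, p.1 - p.2) := by
  symm
  have key : ∀ (n : ℕ) (p : ℤ × ℤ), p ∈ P2 n ↔ p.1 ^ 2 + p.2 ^ 2 = (n : ℤ) := by
    intro n p
    rw [mem_P2, ← Int.natAbs_sq p.1, ← Int.natAbs_sq p.2]
    exact_mod_cast Iff.rfl
  have par : ∀ p : ℤ × ℤ, p ∈ P2 (2 * k) → (p.1 + p.2) % 2 = 0 := by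
    intro p hp
    rw [key] at hp
    push_cast at hp
    have h1 : (p.1 ^ 2 + p.2 ^ 2) % 2 = 0 := by omega
    rcases Int.emod_two_eq_zero_or_one p.1 with h | h <;>
      rcases Int.emod_two_eq_zero_or_one p.2 with h' | h' <;>
      simp [pow_two, Int.add_emod, Int.mul_emod, h, h'] at h1 ⊢
  refine Finset.sum_bij' (fun p _ => (p.1 + p.2, p.1 - p.2))
    (fun p _ => ((p.1 + p.2) / 2, (p.1 - p.2) / 2)) ?_ ?_ ?_ ?_ ?_
  · intro p hp
    rw [key] at hp ⊢
    push_cast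
    linarith [hp, show (p.1 + p.2) ^ 2 + (p.1 - p.2) ^ 2 = 2 * (p.1 ^ 2 + p.2 ^ 2) by ring]
  · intro p hp
    have h0 := par p hp
    rw [key] at hp ⊢
    push_cast at hp
    obtain ⟨u, hu⟩ : ∃ u, p.1 + p.2 = 2 * u := ⟨(p.1 + p.2) / 2, by omega⟩
    have h2 : p.1 - p.2 = 2 * (u - p.2) := by linarith
    simp only [hu, h2]
    rw [Int.mul_ediv_cancel_left _ (by norm_num), Int.mul_ediv_cancel_left _ (by norm_num)]
    have : p.1 = 2 * u - p.2 := by linarith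
    rw [this] at hp
    nlinarith
  · intro p hp
    ext <;> simp only <;> omega
  · intro p hp
    have h0 := par p hp
    ext <;> simp only <;> omega
  · intro p hp; rfl

lemma card_P2_double (k : ℕ) : ((P2 (2 * k)).card : ℚ) = (P2 k).card := by
  have := sum_P2_double k (fun _ => 1)
  simpa using this

lemma neg_one_pow_natAbs_sq (b : ℤ) : (-1 : ℚ) ^ (b.natAbs ^ 2) = if Even b then 1 else -1 := by
  split_ifs with h
  · exact Even.neg_one_pow (by rw [Nat.even_pow]; exact ⟨Int.natAbs_even.2 h, by norm_num⟩)
  · rw [Int.not_even_iff_odd] at h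
    exact Odd.neg_one_pow (Odd.pow (Int.natAbs_odd.2 h))

lemma coeff_thph_even (k : ℕ) :
    PowerSeries.coeff (2 * k) (th * ph) = (-1) ^ k * ((P2 k).card : ℚ) := by
  unfold th ph; rw [coeff_thetaW_mul, sum_P2_double]
  rw [Finset.sum_congr rfl (g := fun _ => (-1 : ℚ) ^ k)]
  · simp [mul_comm]
  · intro p hp
    rw [mem_P2] at hp
    rw [one_mul, neg_one_pow_natAbs_sq, ← hp, pow_add, neg_one_pow_natAbs_sq, neg_one_pow_natAbs_sq]
    by_cases h1 : Even p.1 <;> by_cases h2 : Even p.2 <;> simp [h1, h2, Int.even_sub]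

lemma coeff_thph_odd (n : ℕ) (hn : Odd n) : PowerSeries.coeff n (th * ph) = 0 := by
  have h1 := coeff_thetaW_mul (fun _ => 1) (fun n => (-1) ^ n) n
  have h2 := coeff_thetaW_mul (fun n => (-1) ^ n) (fun _ => 1) n
  rw [mul_comm] at h2
  have : ∑ p ∈ P2 n, (-1 : ℚ) ^ (p.1.natAbs ^ 2) * 1 = - ∑ p ∈ P2 n, 1 * (-1 : ℚ) ^ (p.2.natAbs ^ 2) := by
    rw [← Finset.sum_neg_distrib]
    refine Finset.sum_congr rfl fun p hp => ?_
    rw [mem_P2] at hp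
    have h3 : (-1 : ℚ) ^ (p.1.natAbs ^ 2) * (-1 : ℚ) ^ (p.2.natAbs ^ 2) = -1 := by
      rw [← pow_add, hp]; exact hn.neg_one_pow
    rcases neg_one_pow_eq_or ℚ (p.2.natAbs ^ 2) with h | h <;> rw [h] at h3 ⊢ <;> linarith
  unfold th ph
  linarith

def sg : PowerSeries ℚ →ₐ[ℚ] PowerSeries ℚ := PowerSeries.expand 2 two_ne_zero

lemma coeff_sg_even (k : ℕ) (f : PowerSeries ℚ) :
    PowerSeries.coeff (2 * k) (sg f) = PowerSeries.coeff k f := by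
  unfold sg; rw [PowerSeries.coeff_expand_mul]

lemma coeff_sg_odd (n : ℕ) (hn : Odd n) (f : PowerSeries ℚ) :
    PowerSeries.coeff n (sg f) = 0 := by
  unfold sg; rw [PowerSeries.coeff_expand_of_not_dvd]
  rw [← even_iff_two_dvd]; exact Nat.not_even_iff_odd.2 hn

lemma landen1 : 2 * sg (th * th) = th * th + ph * ph := by
  ext n
  rw [two_mul, map_add, map_add, coeff_thth, coeff_phph]
  rcases Nat.even_or_odd n with h | h
  · obtain ⟨k, rfl⟩ := even_iff_two_dvd.1 h
    rw [coeff_sg_even, coeff_thth, h.neg_one_pow, card_P2_double]; ring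
  · rw [coeff_sg_odd n h, h.neg_one_pow]; ring

lemma landen2 : sg (ph * ph) = th * ph := by
  ext n
  rcases Nat.even_or_odd n with h | h
  · obtain ⟨k, rfl⟩ := even_iff_two_dvd.1 h
    rw [coeff_sg_even, coeff_phph, coeff_thph_even]
  · rw [coeff_sg_odd n h, coeff_thph_odd n h]

lemma coeff_ph_ne_zero_iff (n : ℕ) : PowerSeries.coeff n ph ≠ 0 ↔ ∃ k : ℤ, (n : ℤ) = k ^ 2 := by
  have h : PowerSeries.coeff n ph = (P1 n).card * (-1) ^ n := by
    unfold ph thetaW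
    rw [PowerSeries.coeff_mk, Finset.sum_congr rfl (g := fun _ => (-1 : ℚ) ^ n)]
    · simp
    · intro a ha; rw [mem_P1] at ha; rw [ha]
  rw [h]
  have : (-1 : ℚ) ^ n ≠ 0 := pow_ne_zero _ (by norm_num)
  simp only [ne_eq, mul_eq_zero, this, or_false, Nat.cast_eq_zero, Finset.card_eq_zero]
  rw [← ne_eq, ← Finset.nonempty_iff_ne_empty]
  constructor
  · rintro ⟨a, ha⟩
    rw [mem_P1] at ha
    exact ⟨a, by rw [← ha]; push_cast; simp⟩
  · rintro ⟨k, hk⟩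
    refine ⟨k, ?_⟩
    rw [mem_P1]
    zify
    rw [hk]; simp

lemma coeff0_th : PowerSeries.coeff 0 th = 1 := by
  have : P1 0 = {0} := by decide
  simp [th, thetaW, this]

lemma coeff1_th : PowerSeries.coeff 1 th = 2 := by
  have : P1 1 = {-1, 1} := by decide
  simp [th, thetaW, this]

lemma coeff0_ph : PowerSeries.coeff 0 ph = 1 := by
  have : P1 0 = {0} := by decide
  simp [ph, thetaW, this]

lemma coeff1_ph : PowerSeries.coeff 1 ph = -2 := by
  have : P1 1 = {-1, 1} := by decide
  simp [ph, thetaW, this]; norm_num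

end QP

namespace QP

/-- Euler derivation `q d/dq` on power series. -/
def dl {k : Type*} [CommRing k] (f : PowerSeries k) : PowerSeries k :=
  PowerSeries.X * PowerSeries.derivative k f

section
variable {k : Type*} [CommRing k]

lemma dl_add (f g : PowerSeries k) : dl (f + g) = dl f + dl g := by
  simp [dl, mul_add]

lemma dl_mul (f g : PowerSeries k) : dl (f * g) = dl f * g + f * dl g := by
  simp only [dl, Derivation.leibniz, smul_eq_mul]; ring

lemma coeff_dl (n : ℕ) (f : PowerSeries k) :
    PowerSeries.coeff n (dl f) = n * PowerSeries.coeff n f := by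
  unfold dl
  cases n with
  | zero => simp
  | succ n =>
    rw [PowerSeries.coeff_succ_X_mul, PowerSeries.coeff_derivative]; push_cast; ring

lemma dl_sum {ι : Type*} (s : Finset ι) (f : ι → PowerSeries k) :
    dl (∑ i ∈ s, f i) = ∑ i ∈ s, dl (f i) := by
  simp [dl, Finset.mul_sum]

lemma dl_C (c : k) : dl (PowerSeries.C c) = 0 := by simp [dl]

lemma dl_sub (f g : PowerSeries k) : dl (f - g) = dl f - dl g := by
  simp [dl, mul_sub]

lemma dl_one : dl (1 : PowerSeries k) = 0 := by simp [dl]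

lemma dl_pow (f : PowerSeries k) (n : ℕ) : f * dl (f ^ n) = n * f ^ n * dl f := by
  induction n with
  | zero => simp [dl_one]
  | succ n ih =>
    rw [pow_succ, dl_mul]; push_cast
    linear_combination f * ih

lemma dl_eq_zero_iff [CharZero k] [IsDomain k] (f : PowerSeries k) (h : dl f = 0) :
    f = PowerSeries.C (PowerSeries.coeff 0 f) := by
  ext n
  rw [PowerSeries.coeff_C]
  split_ifs with hn
  · rw [hn]
  · have := congrArg (PowerSeries.coeff n) h
    rw [coeff_dl, map_zero, mul_eq_zero] at this
    rcases this with h | h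
    · exact absurd (by exact_mod_cast h) hn
    · exact h

lemma dl_map {l : Type*} [CommRing l] (φ : k →+* l) (f : PowerSeries k) :
    dl (PowerSeries.map φ f) = PowerSeries.map φ (dl f) := by
  ext n; simp [coeff_dl]
end

lemma ofN (n : ℕ) [n.AtLeastTwo] :
    (OfNat.ofNat n : PowerSeries ℚ) = PowerSeries.C (OfNat.ofNat n) := (map_ofNat PowerSeries.C n).symm

lemma dl_sg (f : PowerSeries ℚ) : dl (sg f) = 2 * sg (dl f) := by
  ext n
  rw [coeff_dl, two_mul, map_add]
  rcases Nat.even_or_odd n with h | h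
  · obtain ⟨k, rfl⟩ := even_iff_two_dvd.1 h
    rw [coeff_sg_even, coeff_sg_even, coeff_dl]; push_cast; ring
  · rw [coeff_sg_odd n h, coeff_sg_odd n h]; ring

lemma eq_zero_of_four_sg (y : PowerSeries ℚ) (h : 4 * sg y = y) : y = 0 := by
  have hc : ∀ n, 4 * PowerSeries.coeff n (sg y) = PowerSeries.coeff n y := by
    intro n
    have := congrArg (PowerSeries.coeff n) h
    rw [← this, ofN 4, PowerSeries.coeff_C_mul]
  ext n
  rw [map_zero]
  induction n using Nat.strong_induction_on with
  | _ n ih =>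
    rcases Nat.even_or_odd n with h | h
    · obtain ⟨k, rfl⟩ := even_iff_two_dvd.1 h
      have := hc (2 * k)
      rw [coeff_sg_even] at this
      rcases Nat.eq_zero_or_pos k with rfl | hk
      · simp only [mul_zero] at this ⊢; linarith
      · rw [ih k (by omega)] at this; linarith
    · have := hc n
      rw [coeff_sg_odd n h] at this; linarith

lemma eq_zero_of_sg (u v W : PowerSeries ℚ) (h : u * sg W = v * W)
    (hu : PowerSeries.coeff 0 u ≠ 0) (hv : PowerSeries.order v = 1)
    (h1 : PowerSeries.coeff 1 W = 0) : W = 0 := by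
  by_contra hW
  have h2 := congrArg PowerSeries.order h
  have hu0 : u.order = 0 := by
    rw [← Nat.cast_zero, PowerSeries.order_eq_nat]; exact ⟨hu, by simp⟩
  rw [PowerSeries.order_mul, PowerSeries.order_mul, hu0, hv, sg, PowerSeries.order_expand] at h2
  obtain ⟨n, hn⟩ := ENat.ne_top_iff_exists.1 (PowerSeries.order_eq_top.not.2 hW)
  rw [← hn] at h2
  have h3 : 2 * n = 1 + n := by
    have : ((2 * n : ℕ) : ℕ∞) = ((1 + n : ℕ) : ℕ∞) := by push_cast; simpa using h2
    exact_mod_cast this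
  have h4 : n = 1 := by omega
  subst h4
  have := (PowerSeries.order_eq_nat.1 hn.symm).1
  exact this h1

def TA : PowerSeries ℚ := th * th
def TB : PowerSeries ℚ := ph * ph
def TD : PowerSeries ℚ := TA ^ 2 - TB ^ 2
def et : PowerSeries ℚ := ph⁻¹ * dl ph

lemma ph_inv : ph * ph⁻¹ = 1 :=
  PowerSeries.mul_inv_cancel _ (by rw [← PowerSeries.coeff_zero_eq_constantCoeff_apply, coeff0_ph]; norm_num)

lemma cc_th : PowerSeries.constantCoeff th = 1 := by
  rw [← PowerSeries.coeff_zero_eq_constantCoeff_apply, coeff0_th]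
lemma cc_ph : PowerSeries.constantCoeff ph = 1 := by
  rw [← PowerSeries.coeff_zero_eq_constantCoeff_apply, coeff0_ph]
lemma cc_TA : PowerSeries.constantCoeff TA = 1 := by simp [TA, cc_th]
lemma cc_TB : PowerSeries.constantCoeff TB = 1 := by simp [TB, cc_ph]
lemma c1_TA : PowerSeries.coeff 1 TA = 4 := by
  simp [TA, PowerSeries.coeff_one_mul, coeff1_th, cc_th]; norm_num
lemma c1_TB : PowerSeries.coeff 1 TB = -4 := by
  simp [TB, PowerSeries.coeff_one_mul, coeff1_ph, cc_ph]; norm_num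
lemma cc_TD : PowerSeries.constantCoeff TD = 0 := by simp [TD, cc_TA, cc_TB]
lemma c1_TD : PowerSeries.coeff 1 TD = 16 := by
  simp [TD, pow_two, PowerSeries.coeff_one_mul, c1_TA, c1_TB, cc_TA, cc_TB]; norm_num

lemma ph_ne : ph ≠ 0 := by intro h; have := cc_ph; simp [h] at this
lemma TA_ne : TA ≠ 0 := by intro h; have := cc_TA; simp [h] at this
lemma TB_ne : TB ≠ 0 := by intro h; have := cc_TB; simp [h] at this

lemma sA : 2 * sg TA = TA + TB := landen1
lemma sB : sg TB * sg TB = TA * TB := by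
  have h : sg TB = th * ph := landen2
  rw [h]; simp only [TA, TB]; ring

lemma two_sg (f : PowerSeries ℚ) : sg (2 * f) = 2 * sg f := by
  rw [two_mul, map_add, two_mul]

lemma sdA : 4 * sg (dl TA) = dl TA + dl TB := by
  have := congrArg dl sA
  rw [two_mul, dl_add, dl_add, dl_sg] at this
  linear_combination this

lemma sdB : 4 * sg TB * sg (dl TB) = TA * dl TB + TB * dl TA := by
  have := congrArg dl sB
  rw [dl_mul, dl_mul, dl_sg] at this
  linear_combination this

/-- twice the first obstruction -/
def WW : PowerSeries ℚ := 2 * (TA * dl TB - TB * dl TA) + TA * TB * TD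

lemma sWW : 8 * sg TB * sg WW = (TA - TB) * WW := by
  have h : sg WW = 2 * (sg TA * sg (dl TB) - sg TB * sg (dl TA)) +
      sg TA * sg TB * ((sg TA) ^ 2 - (sg TB) ^ 2) := by
    simp only [WW, TD, map_add, map_mul, map_sub, map_pow, map_ofNat]
  have hA : sg TA = PowerSeries.C (1/2) * (TA + TB) := by
    rw [← sA, ← mul_assoc, ofN 2, ← map_mul]
    norm_num
  have hc : 2 * PowerSeries.C (1/2 : ℚ) = 1 := by
    rw [ofN 2, ← map_mul]; norm_num
  rw [h]
  have h1 := sA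
  have h2 := sB
  have h3 := sdA
  have h4 := sdB
  generalize sg TA = a at *
  generalize sg TB = b at *
  generalize sg (dl TA) = a' at *
  generalize sg (dl TB) = b' at *
  unfold WW TD
  generalize dl TA = A' at *
  generalize dl TB = B' at *
  generalize TA = A at *
  generalize TB = B at *
  have e1 : 8 * b * (2 * (a * b' - b * a') + a * b * (a^2 - b^2))
     = 2 * (2*a) * (4 * b * b') - 4 * (b*b) * (4 * a') + (2*a) * (b * b) * ((2*a)^2 - 4 * (b*b)) := by
    ring
  rw [e1, h4, h3, h2, h1]
  ring

lemma WW_zero : WW = 0 := by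
  refine eq_zero_of_sg (8 * sg TB) (TA - TB) WW sWW ?_ ?_ ?_
  · rw [PowerSeries.coeff_zero_eq_constantCoeff_apply, map_mul]
    have : PowerSeries.constantCoeff (sg TB) = 1 := by
      rw [← PowerSeries.coeff_zero_eq_constantCoeff_apply]
      have := coeff_sg_even 0 TB
      rw [mul_zero] at this
      rw [this, PowerSeries.coeff_zero_eq_constantCoeff_apply, cc_TB]
    rw [this, map_ofNat]; norm_num
  · rw [← Nat.cast_one, PowerSeries.order_eq_nat]
    refine ⟨?_, ?_⟩
    · rw [map_sub, c1_TA, c1_TB]; norm_num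
    · intro i hi
      have : i = 0 := by omega
      subst this
      simp [cc_TA, cc_TB]
  · have h2 := ofN 2
    have hdA : PowerSeries.constantCoeff (dl TA) = 0 := by simp [dl]
    have hdB : PowerSeries.constantCoeff (dl TB) = 0 := by simp [dl]
    rw [WW, h2, map_add, PowerSeries.coeff_C_mul, map_sub]
    simp only [PowerSeries.coeff_one_mul, coeff_dl, c1_TA, c1_TB, cc_TA, cc_TB, c1_TD, cc_TD, hdA, hdB,
      map_mul]
    norm_num

lemma dlph : dl ph = ph * et := by
  rw [et, ← mul_assoc, ph_inv, one_mul]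

lemma dlTB : dl TB = 2 * TB * et := by
  rw [TB, dl_mul, dlph]; ring

lemma I1 : 2 * dl TA = TA * (TD + 4 * et) := by
  have h := WW_zero
  unfold WW at h
  rw [dlTB] at h
  have : TB * (2 * dl TA) = TB * (TA * (TD + 4 * et)) := by linear_combination -h
  exact mul_left_cancel₀ TB_ne this

lemma set : 16 * sg et = 8 * et + TD := by
  have h1 : sg (dl TB) = 2 * sg TB * sg et := by
    rw [dlTB, map_mul, two_sg]
  have h := sdB
  rw [h1, dlTB] at h
  have : (TA * TB) * (16 * sg et) = (TA * TB) * (8 * et + TD) := by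
    rw [← sB]
    have h2 := sB
    have h3 := I1
    linear_combination 2 * h + TB * h3 - (8 * et + TD) * h2
  exact mul_left_cancel₀ (mul_ne_zero TA_ne TB_ne) this

lemma dlTD : dl TD = 4 * TD * et + TA ^ 2 * TD := by
  rw [TD, dl_sub, pow_two, pow_two, dl_mul, dl_mul, dlTB]
  have := I1
  unfold TD at this
  linear_combination 2 * TA * this - TA * this

lemma I2 : 8 * dl et = 16 * et ^ 2 - TD * TA ^ 2 := by
  have : 8 * dl et - 16 * et ^ 2 + TD * TA ^ 2 = 0 := by
    apply eq_zero_of_four_sg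
    have hc (n : ℕ) (f : PowerSeries ℚ) : sg ((n : PowerSeries ℚ) * f) = n * sg f := by
      rw [map_mul, map_natCast]
    have e : sg (8 * dl et - 16 * et ^ 2 + TD * TA ^ 2)
        = 8 * sg (dl et) - 16 * (sg et) ^ 2 + ((sg TA)^2 - (sg TB) ^ 2) * (sg TA) ^ 2 := by
      have h8 := hc 8 (dl et)
      have h16 := hc 16 (et ^ 2)
      push_cast at h8 h16
      simp only [TD, map_add, map_sub, map_mul, map_pow, h8, h16]
    have h1 : 32 * sg (dl et) = 8 * dl et + dl TD := by
      have := congrArg dl set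
      have h16 : ∀ f : PowerSeries ℚ, dl (16 * f) = 16 * dl f := by
        intro f
        rw [dl_mul, ofN 16, dl_C]; ring
      have h8 : ∀ f : PowerSeries ℚ, dl (8 * f) = 8 * dl f := by
        intro f
        rw [dl_mul, ofN 8, dl_C]; ring
      rw [dl_add, h16, h8, dl_sg] at this
      linear_combination this
    rw [dlTD] at h1
    have h2 := set
    have h3 := sA
    have h4 := sB
    have h16 : (16 : PowerSeries ℚ) ≠ 0 := by
      rw [ofN 16]; exact (map_ne_zero_iff _ PowerSeries.C_injective).2 (by norm_num)
    apply mul_left_cancel₀ h16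
    rw [e]
    have e2 : 16 * (4 * (8 * sg (dl et) - 16 * (sg et) ^ 2 + ((sg TA)^2 - (sg TB) ^ 2) * (sg TA) ^ 2))
      = 16 * (32 * sg (dl et)) - 4 * (16 * sg et) ^ 2 + 4 * ((2 * sg TA)^2 - 4 * (sg TB * sg TB)) * (2 * sg TA)^2 := by ring
    rw [e2, h1, h2, h3, h4]
    unfold TD
    ring
  linear_combination this

def xx : PowerSeries ℚ := TD * (TA ^ 2)⁻¹

lemma xxA : xx * TA ^ 2 = TD := by
  rw [xx, mul_assoc, PowerSeries.inv_mul_cancel, mul_one]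
  simp [cc_TA]

lemma dlxx : dl xx = xx * TB ^ 2 := by
  have h := congrArg dl xxA
  rw [dl_mul, dlTD, pow_two, dl_mul] at h
  have h1 := I1
  have hx := xxA
  have : TA ^ 2 * dl xx = TA ^ 2 * (xx * TB ^ 2) := by
    unfold TD at *
    linear_combination h - xx * TA * h1 + (- (4 * et + TA ^ 2)) * hx
  exact mul_left_cancel₀ (pow_ne_zero 2 TA_ne) this

lemma cc_xx : PowerSeries.constantCoeff xx = 0 := by simp [xx, cc_TD]

lemma c1_xx : PowerSeries.coeff 1 xx = 16 := by
  have h := congrArg (PowerSeries.coeff 1) xxA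
  rw [PowerSeries.coeff_one_mul, c1_TD, cc_xx] at h
  simpa [cc_TA] using h

end QP

namespace QP

abbrev KK := PowerSeries ℚ[X]

def pt (f : KK) : KK := PowerSeries.mk fun n => Polynomial.derivative (PowerSeries.coeff n f)

lemma coeff_pt (n : ℕ) (f : KK) :
    PowerSeries.coeff n (pt f) = Polynomial.derivative (PowerSeries.coeff n f) := by
  simp [pt]

lemma pt_add (f g : KK) : pt (f + g) = pt f + pt g := by
  ext1 n; simp [coeff_pt]

lemma pt_sub (f g : KK) : pt (f - g) = pt f - pt g := by
  ext1 n; simp [coeff_pt]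

lemma pt_mul (f g : KK) : pt (f * g) = pt f * g + f * pt g := by
  ext1 n
  simp only [coeff_pt, PowerSeries.coeff_mul, map_add, Polynomial.derivative_sum,
    Polynomial.derivative_mul, Finset.sum_add_distrib]

lemma pt_dl (f : KK) : pt (dl f) = dl (pt f) := by
  ext1 n; simp [coeff_pt, coeff_dl]

def io : PowerSeries ℚ →+* KK := PowerSeries.map Polynomial.C
def tt : KK := PowerSeries.C Polynomial.X

lemma pt_io (f : PowerSeries ℚ) : pt (io f) = 0 := by
  ext1 n; simp [coeff_pt, io]
lemma pt_tt : pt tt = 1 := by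
  ext1 n; rw [coeff_pt, tt, PowerSeries.coeff_C, PowerSeries.coeff_one]; split_ifs <;> simp
lemma dl_tt : dl tt = 0 := dl_C _
lemma dl_io (f : PowerSeries ℚ) : dl (io f) = io (dl f) := dl_map _ _
lemma pt_nat (n : ℕ) : pt (n : KK) = 0 := by
  have : (n : KK) = io n := by simp
  rw [this, pt_io]
lemma dl_nat (n : ℕ) : dl (n : KK) = 0 := by
  have : (n : KK) = PowerSeries.C (n : ℚ[X]) := by simp
  rw [this, dl_C]

lemma coeff0_dl (f : KK) : PowerSeries.constantCoeff (dl f) = 0 := by simp [dl]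

lemma dl_unique (a Z : KK) (ha : PowerSeries.constantCoeff a = 0)
    (hZ : PowerSeries.constantCoeff Z = 0) (h : dl Z = a * Z) : Z = 0 := by
  ext1 n
  rw [map_zero]
  induction n using Nat.strong_induction_on with
  | _ n ih =>
    rcases Nat.eq_zero_or_pos n with rfl | hn
    · simpa using hZ
    · have h1 := congrArg (PowerSeries.coeff n) h
      rw [coeff_dl, PowerSeries.coeff_mul, Finset.sum_eq_zero] at h1
      · rcases mul_eq_zero.1 h1 with h2 | h2
        · exact absurd (by exact_mod_cast h2) hn.ne'
        · exact h2
      · rintro ⟨i, j⟩ hij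
        rw [Finset.HasAntidiagonal.mem_antidiagonal] at hij
        simp only at hij ⊢
        rcases Nat.eq_zero_or_pos i with rfl | hi
        · rw [PowerSeries.coeff_zero_eq_constantCoeff_apply, ha, zero_mul]
        · rw [ih j (by omega), mul_zero]

lemma dl_exists (a : KK) (ha : PowerSeries.constantCoeff a = 0) :
    ∃ Y : KK, PowerSeries.constantCoeff Y = 1 ∧ dl Y = a * Y := by
  let w : KK := PowerSeries.mk fun n => Polynomial.C (1 / (n : ℚ)) * PowerSeries.coeff n a
  have hw0 : PowerSeries.constantCoeff w = 0 := by
    rw [← PowerSeries.coeff_zero_eq_constantCoeff_apply]; simp [w]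
  have hw : dl w = a := by
    ext1 n
    rw [coeff_dl]
    rcases Nat.eq_zero_or_pos n with rfl | hn
    · simp [ha]
    · simp only [w, PowerSeries.coeff_mk]
      rw [← mul_assoc, ← Polynomial.C_eq_natCast, ← Polynomial.C_mul, mul_one_div_cancel, Polynomial.C_1, one_mul]
      exact_mod_cast hn.ne'
  have hs : PowerSeries.HasSubst w := PowerSeries.HasSubst.of_constantCoeff_zero' hw0
  refine ⟨PowerSeries.subst w (PowerSeries.exp ℚ[X]), ?_, ?_⟩
  · change MvPowerSeries.constantCoeff _ = 1
    have hw0' : MvPowerSeries.constantCoeff w = 0 := hw0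
    rw [PowerSeries.constantCoeff_subst hs, finsum_eq_single _ 0]
    · simp
    · intro d hd
      rw [map_pow, hw0', zero_pow hd, smul_zero]
  · rw [dl, PowerSeries.derivative_subst hs, PowerSeries.derivative_exp, ← hw, dl]; ring

lemma exists_Y (a b : KK) (ha : PowerSeries.constantCoeff a = 0)
    (hb : PowerSeries.constantCoeff b = 0) (hab : pt a = dl b) :
    ∃ Y : KK, PowerSeries.constantCoeff Y = 1 ∧ dl Y = a * Y ∧ pt Y = b * Y := by
  obtain ⟨Y, h0, h1⟩ := dl_exists a ha
  refine ⟨Y, h0, h1, ?_⟩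
  have : pt Y - b * Y = 0 := by
    refine dl_unique a _ ha ?_ ?_
    · rw [map_sub, map_mul, hb, ← PowerSeries.coeff_zero_eq_constantCoeff_apply, coeff_pt]
      simp [h0]
    · rw [dl_sub, dl_mul, ← pt_dl, h1, pt_mul, hab]; ring
  exact sub_eq_zero.1 this

def dd : PowerSeries ℚ := PowerSeries.C (1/8) * TD

lemma TD_eq : TD = 8 * dd := by
  rw [dd, ofN 8, ← mul_assoc, ← map_mul]; norm_num

lemma I1' : dl TA = TA * (4 * dd + 2 * et) := by
  have h2 : (2 : PowerSeries ℚ) ≠ 0 := by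
    rw [ofN 2]; exact (map_ne_zero_iff _ PowerSeries.C_injective).2 (by norm_num)
  apply mul_left_cancel₀ h2
  rw [I1, TD_eq]; ring

lemma I2' : dl et = 2 * et ^ 2 - dd * TA ^ 2 := by
  have h2 : (8 : PowerSeries ℚ) ≠ 0 := by
    rw [ofN 8]; exact (map_ne_zero_iff _ PowerSeries.C_injective).2 (by norm_num)
  apply mul_left_cancel₀ h2
  rw [I2, TD_eq]; ring

lemma cc_io (f : PowerSeries ℚ) : PowerSeries.constantCoeff (io f) = Polynomial.C (PowerSeries.constantCoeff f) := by
  rw [← PowerSeries.coeff_zero_eq_constantCoeff_apply, io, PowerSeries.coeff_map,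
    PowerSeries.coeff_zero_eq_constantCoeff_apply]

lemma cc_et : PowerSeries.constantCoeff et = 0 := by simp [et, dl]
lemma cc_dd : PowerSeries.constantCoeff dd = 0 := by simp [dd, cc_TD]

lemma main_Y (j : ℕ) : ∃ Y : KK, PowerSeries.constantCoeff Y = 1 ∧
    (io TA ^ 2 * (pt Y + j * Y) - io dd * (8 * tt - 2 * tt ^ 2) * (pt Y + j * Y) + io dd * tt * Y
      - j * Y - dl Y = 0) ∧
    ph * PowerSeries.map (Polynomial.evalRingHom 0) Y = 1 := by
  obtain ⟨A, hA⟩ : ∃ A, A = io TA := ⟨_, rfl⟩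
  obtain ⟨d, hd⟩ : ∃ d, d = io dd := ⟨_, rfl⟩
  obtain ⟨e, he⟩ : ∃ e, e = io et := ⟨_, rfl⟩
  have A1 : dl A = A * (4 * d + 2 * e) := by
    rw [hA, dl_io, I1', hd, he]; simp only [map_mul, map_add, map_ofNat]
  have e1 : dl e = 2 * e ^ 2 - d * A ^ 2 := by
    rw [he, dl_io, I2', hA, hd]; simp only [map_mul, map_sub, map_pow, map_ofNat]
  have pA : pt A = 0 := by rw [hA, pt_io]
  have pe : pt e = 0 := by rw [he, pt_io]
  have pd : pt d = 0 := by rw [hd, pt_io]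
  have ptwo : pt (2 : KK) = 0 := by simpa using pt_nat 2
  have pfour : pt (4 : KK) = 0 := by simpa using pt_nat 4
  have pone : pt (1 : KK) = 0 := by simpa using pt_nat 1
  have dtwo : dl (2 : KK) = 0 := by simpa using dl_nat 2
  have ptt := pt_tt
  have dtt := dl_tt
  have pj := pt_nat j
  have dj := dl_nat j
  have cA : PowerSeries.constantCoeff A = 1 := by rw [hA, cc_io, cc_TA]; simp
  have ce : PowerSeries.constantCoeff e = 0 := by rw [he, cc_io, cc_et]; simp
  have cd : PowerSeries.constantCoeff d = 0 := by rw [hd, cc_io, cc_dd]; simp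
  obtain ⟨U, hU⟩ : ∃ U, U = A ^ 2 + 2 * tt * e := ⟨_, rfl⟩
  obtain ⟨h, hh⟩ : ∃ h, h = A ^ 2 * (4 * d + 2 * e) + tt * (2 * e ^ 2 - d * A ^ 2) := ⟨_, rfl⟩
  have cU : PowerSeries.constantCoeff U = 1 := by rw [hU]; simp [cA, ce]
  have ch : PowerSeries.constantCoeff h = 0 := by rw [hh]; simp [cd, ce]
  have pU : pt U = 2 * e := by
    rw [hU]; simp only [pow_two, pt_add, pt_mul, pA, pe, ptwo, ptt]; ring
  have dU : dl U = 2 * h := by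
    rw [hU, hh]; simp only [pow_two, dl_add, dl_mul, A1, e1, dtwo, dtt]; ring
  have ph' : pt h = 2 * e ^ 2 - d * A ^ 2 := by
    rw [hh]; simp only [pow_two, pt_add, pt_sub, pt_mul, pA, pe, ptwo, pfour, ptt, pd]; ring
  obtain ⟨V, hV⟩ : ∃ V, U * V = 1 := ⟨_, PowerSeries.mul_invOfUnit U 1 (by simp [cU])⟩
  have cV : PowerSeries.constantCoeff V = 1 := by
    have := congrArg PowerSeries.constantCoeff hV
    simpa [cU] using this
  have hU0 : U ≠ 0 := left_ne_zero_of_mul_eq_one hV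
  have pV : pt V = - (2 * e * V ^ 2) := by
    have h1 := congrArg pt hV
    rw [pt_mul, pU, pone] at h1
    apply mul_left_cancel₀ hU0
    linear_combination h1 - (-(2 * e * V)) * hV
  have dV : dl V = - (2 * h * V ^ 2) := by
    have h1 := congrArg dl hV
    rw [dl_mul, dU, dl_one] at h1
    apply mul_left_cancel₀ hU0
    linear_combination h1 + 2 * h * V * hV
  obtain ⟨a, ha⟩ : ∃ a, a = 4 * d + e - 2 * (j : KK) * tt * (V * V) * h - h * V := ⟨_, rfl⟩
  obtain ⟨b, hb⟩ : ∃ b, b = (j : KK) * (V - 2 * tt * e * (V * V) - 1) - e * V := ⟨_, rfl⟩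
  have ctt : PowerSeries.constantCoeff tt = Polynomial.X := by simp [tt]
  obtain ⟨Y, y0, y1, y2⟩ := exists_Y a b (by rw [ha]; simp [cd, ce, ch]) (by rw [hb]; simp [ce, cV]) (by
    rw [ha, hb]
    simp only [pt_add, pt_sub, pt_mul, pA, pe, pd, ptwo, pfour, ptt, pj, pV, ph', dl_add, dl_sub, dl_mul,
      dV, dtwo, dtt, dj, e1, dl_one]
    ring)
  refine ⟨Y, y0, ?_, ?_⟩
  · rw [y1, y2, ← hA, ← hd]
    have key : A ^ 2 * (b + j) - d * (8 * tt - 2 * tt ^ 2) * (b + j) + d * tt - j - a = 0 := by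
      apply mul_left_cancel₀ (pow_ne_zero 2 hU0)
      obtain ⟨c1, hc1⟩ : ∃ c1, c1 = U * V := ⟨_, rfl⟩
      have : U ^ 2 * (A ^ 2 * (b + j) - d * (8 * tt - 2 * tt ^ 2) * (b + j) + d * tt - j - a)
        = (A ^ 2 - d * (8 * tt - 2 * tt ^ 2)) * (j * (U * (U * V) - 2 * tt * e * (U * V) ^ 2) - e * U * (U * V))
          + d * tt * U ^ 2 - j * U ^ 2 - (4 * d + e) * U ^ 2 + 2 * j * tt * (U * V) ^ 2 * h + h * U * (U * V) := by
        rw [ha, hb]; ring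
      rw [this, hV, hU, hh]
      ring
    linear_combination Y * key
  · obtain ⟨y, hy⟩ : ∃ y, y = PowerSeries.map (Polynomial.evalRingHom (0:ℚ)) Y := ⟨_, rfl⟩
    rw [← hy]
    have evio : ∀ f, PowerSeries.map (Polynomial.evalRingHom (0:ℚ)) (io f) = f := by
      intro f; ext n; simp [io]
    have evt : PowerSeries.map (Polynomial.evalRingHom (0:ℚ)) tt = 0 := by
      simp [tt]
    have z1 := congrArg (PowerSeries.map (Polynomial.evalRingHom (0:ℚ))) y1
    have z2 := congrArg (PowerSeries.map (Polynomial.evalRingHom (0:ℚ))) hV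
    rw [← dl_map, map_mul, ← hy, ha, hh] at z1
    rw [hU] at z2
    simp only [map_add, map_sub, map_mul, map_pow, hA, hd, he, evio, evt, map_one, map_ofNat] at z1 z2
    have z3 : dl y = - et * y := by
      rw [z1]; linear_combination (- (4 * dd + 2 * et) * y) * z2
    have z4 : dl (ph * y) = 0 := by
      rw [dl_mul, dlph, z3]; ring
    rw [dl_eq_zero_iff _ z4, PowerSeries.coeff_zero_eq_constantCoeff_apply, map_mul, cc_ph, hy,
      ← PowerSeries.coeff_zero_eq_constantCoeff_apply, PowerSeries.coeff_map,
      PowerSeries.coeff_zero_eq_constantCoeff_apply, y0]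
    simp

end QP

namespace QP

abbrev FF := RatFunc ℚ

/-- embedding of polynomials -/
abbrev al : ℚ[X] →+* FF := algebraMap ℚ[X] FF

lemma al_ne {q : ℚ[X]} (hq : q ≠ 0) : al q ≠ 0 :=
  (map_ne_zero_iff _ (RatFunc.algebraMap_injective ℚ)).2 hq

lemma rep_self (f : FF) : f * al f.denom = al f.num :=
  (eq_div_iff (al_ne f.denom_ne_zero)).1 (RatFunc.num_div_denom f).symm

lemma poly_id {n d p q n' d' p' q' : ℚ[X]} (h1 : n * q = p * d)
    (h2 : n' * q + n * q' = p' * d + p * d') :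
    (n' * d - n * d') * q ^ 2 = (p' * q - p * q') * d ^ 2 := by
  linear_combination (q * d) * h2 - (q' * d + q * d') * h1

lemma rd_eq (f : FF) : ratDeriv f * al f.denom ^ 2 =
    al (derivative f.num * f.denom - f.num * derivative f.denom) := by
  have hd : al f.denom ≠ 0 := al_ne f.denom_ne_zero
  rw [ratDeriv, RatFunc.mk_eq_div, map_pow]
  exact div_mul_cancel₀ _ (pow_ne_zero 2 hd)

lemma rd_spec (f : FF) (p q : ℚ[X]) (hq : q ≠ 0) (h : f * al q = al p) :
    ratDeriv f * al q ^ 2 = al (derivative p * q - p * derivative q) := by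
  have hd : al f.denom ≠ 0 := al_ne f.denom_ne_zero
  have hf := rep_self f
  have h1 : f.num * q = p * f.denom := by
    apply RatFunc.algebraMap_injective ℚ
    rw [map_mul, map_mul, ← hf, ← h]; ring
  have h2 := congrArg derivative h1
  rw [derivative_mul, derivative_mul] at h2
  have h3 := congrArg al (poly_id h1 h2)
  rw [map_mul, map_mul, map_pow, map_pow, ← rd_eq] at h3
  apply mul_right_cancel₀ (pow_ne_zero 2 hd)
  rw [← h3]; ring

lemma exists_rep (f : FF) : ∃ p q : ℚ[X], q ≠ 0 ∧ f * al q = al p :=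
  ⟨f.num, f.denom, f.denom_ne_zero,
    (eq_div_iff (al_ne f.denom_ne_zero)).1 (RatFunc.num_div_denom f).symm⟩

lemma rd_mul (f g : FF) : ratDeriv (f * g) = ratDeriv f * g + f * ratDeriv g := by
  obtain ⟨p, q, hq, h⟩ := exists_rep f
  obtain ⟨p', q', hq', h'⟩ := exists_rep g
  have e := rd_spec f p q hq h
  have e' := rd_spec g p' q' hq' h'
  have e2 := rd_spec (f * g) (p * p') (q * q') (mul_ne_zero hq hq') (by
    rw [map_mul, map_mul, ← h, ← h']; ring)
  have h1 := al_ne hq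
  have h2 := al_ne hq'
  apply mul_right_cancel₀ (pow_ne_zero 2 (mul_ne_zero h1 h2))
  rw [map_mul] at e2
  rw [e2, derivative_mul, derivative_mul]
  simp only [map_sub, map_add, map_mul] at e e' ⊢
  linear_combination (-g * al q' ^ 2) * e - (f * al q ^ 2) * e' +
    ((al (derivative p') * al q' - al p' * al (derivative q')) * al q) * (-h) + (al (derivative p) * al q - al p * al (derivative q)) * al q' * (-h')

lemma rd_add (f g : FF) : ratDeriv (f + g) = ratDeriv f + ratDeriv g := by
  obtain ⟨p, q, hq, h⟩ := exists_rep f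
  obtain ⟨p', q', hq', h'⟩ := exists_rep g
  have e := rd_spec f p q hq h
  have e' := rd_spec g p' q' hq' h'
  have e2 := rd_spec (f + g) (p * q' + p' * q) (q * q') (mul_ne_zero hq hq') (by
    rw [map_mul, map_add, map_mul, map_mul, ← h, ← h']; ring)
  have h1 := al_ne hq
  have h2 := al_ne hq'
  apply mul_right_cancel₀ (pow_ne_zero 2 (mul_ne_zero h1 h2))
  rw [map_mul] at e2
  rw [e2, derivative_mul, derivative_add, derivative_mul, derivative_mul]
  simp only [map_sub, map_add, map_mul] at e e' ⊢
  linear_combination (-al q' ^ 2) * e - (al q ^ 2) * e'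

lemma rd_al (p : ℚ[X]) : ratDeriv (al p) = al (derivative p) := by
  have := rd_spec (al p) p 1 one_ne_zero (by simp)
  simpa using this

lemma rd_C (c : ℚ) : ratDeriv (RatFunc.C c) = 0 := by
  rw [← RatFunc.algebraMap_C, rd_al]; simp

lemma rd_Cmul (c : ℚ) (f : FF) : ratDeriv (RatFunc.C c * f) = RatFunc.C c * ratDeriv f := by
  rw [rd_mul, rd_C]; ring

lemma rd_X : ratDeriv (RatFunc.X : FF) = 1 := by
  rw [← RatFunc.algebraMap_X, rd_al]; simp

def Td : FF →+ FF where
  toFun f := RatFunc.X * ratDeriv f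
  map_add' f g := by rw [rd_add]; ring
  map_zero' := by have := rd_C 0; rw [map_zero] at this; rw [this, mul_zero]

def TT : FF →+ FF where
  toFun f := RatFunc.X * ratDeriv (RatFunc.X * f)
  map_add' f g := by rw [mul_add, rd_add]; ring
  map_zero' := by have := rd_C 0; rw [map_zero] at this; rw [mul_zero, this, mul_zero]

lemma Td_apply (f : FF) : Td f = RatFunc.X * ratDeriv f := rfl
lemma TT_apply (f : FF) : TT f = RatFunc.X * ratDeriv (RatFunc.X * f) := rfl

lemma X_ne : (RatFunc.X : FF) ≠ 0 := RatFunc.X_ne_zero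

lemma Td_Cmul (c : ℚ) (f : FF) : Td (RatFunc.C c * f) = RatFunc.C c * Td f := by
  rw [Td_apply, Td_apply, rd_Cmul]; ring

lemma TT_Cmul (c : ℚ) (f : FF) : TT (RatFunc.C c * f) = RatFunc.C c * TT f := by
  rw [TT_apply, TT_apply, mul_left_comm, rd_Cmul]; ring

def NN : FF →+ FF where
  toFun f := - Td f + RatFunc.C (1/8) * TT f + RatFunc.C (1/4) * TT (Td f)
  map_add' f g := by simp only [map_add]; ring
  map_zero' := by simp only [map_zero]; ring

lemma NN_apply (f : FF) : NN f = - Td f + RatFunc.C (1/8) * TT f + RatFunc.C (1/4) * TT (Td f) := rfl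

lemma NN_Cmul (c : ℚ) (f : FF) : NN (RatFunc.C c * f) = RatFunc.C c * NN f := by
  simp only [NN_apply, Td_Cmul, TT_Cmul]; ring

lemma NN_rec (f : FF) : NN f = - (RatFunc.X * ratDeriv f)
    - RatFunc.C (1/8) * (RatFunc.X * ratDeriv (RatFunc.X * f))
    + RatFunc.C (1/4) * (RatFunc.X * ratDeriv (RatFunc.X * ratDeriv (RatFunc.X * f))) := by
  have h : RatFunc.X * ratDeriv (RatFunc.X * ratDeriv (RatFunc.X * f)) = TT f + TT (Td f) := by
    rw [← map_add, TT_apply (f + Td f), Td_apply, rd_mul RatFunc.X f, rd_X, one_mul]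
  rw [h, NN_apply, ← Td_apply, ← TT_apply]
  have : (RatFunc.C (1/4) : FF) = RatFunc.C (1/8) + RatFunc.C (1/8) := by
    rw [← map_add]; norm_num
  rw [this]; ring

/-- `1 - j v` -/
def lj (j : ℕ) : ℚ[X] := 1 - C (j : ℚ) * X

lemma lj_ne (j : ℕ) : lj j ≠ 0 := by
  intro h
  have := congrArg (Polynomial.eval 0) h
  simp [lj] at this

def ee (j k : ℕ) : FF := (k.factorial : FF) * RatFunc.X ^ k / al (lj j) ^ (k + 1)

lemma al_lj (j : ℕ) : al (lj j) = 1 - (j : FF) * RatFunc.X := by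
  simp [lj]

lemma rd_lj (j : ℕ) : ratDeriv (al (lj j)) = - (j : FF) := by
  rw [rd_al]; simp [lj]

lemma rd_pow (f : FF) (n : ℕ) : ratDeriv (f ^ (n + 1)) = (n + 1) * f ^ n * ratDeriv f := by
  induction n with
  | zero => simp
  | succ n ih => rw [pow_succ, rd_mul, ih]; push_cast; ring

lemma rd_nat (n : ℕ) : ratDeriv (n : FF) = 0 := by
  have := rd_C n
  rwa [map_natCast] at this

lemma rd_inv (f : FF) (hf : f ≠ 0) : ratDeriv f⁻¹ = - ratDeriv f / f ^ 2 := by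
  have h := rd_mul f f⁻¹
  rw [mul_inv_cancel₀ hf] at h
  have h1 : ratDeriv (1 : FF) = 0 := by simpa using rd_nat 1
  rw [h1] at h
  field_simp
  field_simp at h
  linear_combination -h

lemma TT_ee_aux {F : Type*} [Field F] (X l c j k : F) (n : ℕ) (hl : l ≠ 0) (h : l = 1 - j * X) :
    X * (0 * (X * l⁻¹) ^ (n + 1) + c * ((k + 1) * (X * l⁻¹) ^ n * (1 * l⁻¹ + X * (- -j / l ^ 2))))
      = (k + 1) * c * X ^ (n + 1) / l ^ (n + 2) := by
  have : 1 * l⁻¹ + X * (- -j / l ^ 2) = 1 / l ^ 2 := by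
    field_simp; rw [h]; ring
  rw [this, zero_mul, zero_add, mul_pow, inv_pow]
  field_simp
  ring

lemma TT_ee (j k : ℕ) : TT (ee j k) = ee j (k + 1) := by
  have hl := al_ne (lj_ne j)
  have e : RatFunc.X * ee j k = (k.factorial : FF) * (RatFunc.X * (al (lj j))⁻¹) ^ (k + 1) := by
    rw [ee, mul_pow, inv_pow, ← div_eq_mul_inv]; ring
  rw [TT_apply, e, rd_mul, rd_nat, rd_pow, rd_mul, rd_X, rd_inv _ hl, rd_lj, ee, Nat.factorial_succ,
    TT_ee_aux _ _ _ _ _ _ hl (al_lj j)]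
  push_cast
  ring

lemma ee_zero (j : ℕ) : (j : FF) * ee j 0 = (ee j 0 - 1) / RatFunc.X := by
  have hl := al_ne (lj_ne j)
  have hX := X_ne
  rw [ee]
  simp only [Nat.factorial_zero, Nat.cast_one, pow_zero, zero_add, pow_one, one_mul]
  field_simp
  rw [al_lj]; ring

lemma ee_succ_aux {F : Type*} [Field F] (X l c j k : F) (n : ℕ) (hl : l ≠ 0) (hX : X ≠ 0)
    (h : l = 1 - j * X) : k * (c * X ^ n / l ^ (n + 1)) + j * (k * c * X ^ (n + 1) / l ^ (n + 2))
      = (k * c * X ^ (n + 1) / l ^ (n + 2)) / X := by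
  have h2 : j = (1 - l) / X := by rw [h]; field_simp; ring
  rw [h2, pow_succ, pow_succ l (n + 1)]
  field_simp
  ring

lemma ee_succ (j k : ℕ) : ((k : FF) + 1) * ee j k + (j : FF) * ee j (k + 1)
    = ee j (k + 1) / RatFunc.X := by
  have hl := al_ne (lj_ne j)
  rw [ee, ee, Nat.factorial_succ]
  push_cast
  exact ee_succ_aux _ _ _ _ _ _ hl X_ne (al_lj j)

def La (j : ℕ) : ℚ[X] →+ FF where
  toFun p := p.sum fun k c => RatFunc.C c * ee j k
  map_zero' := Polynomial.sum_zero_index _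
  map_add' p q := Polynomial.sum_add_index p q _ (fun i => by rw [map_zero, zero_mul])
    (fun i a b => by rw [map_add, add_mul])

lemma La_monomial (j k : ℕ) (c : ℚ) : La j (monomial k c) = RatFunc.C c * ee j k :=
  Polynomial.sum_monomial_index c (fun k c => RatFunc.C c * ee j k) (by rw [map_zero, zero_mul])

lemma La_Cmul (j : ℕ) (c : ℚ) (p : ℚ[X]) : La j (C c * p) = RatFunc.C c * La j p := by
  induction p using Polynomial.induction_on' with
  | add p q hp hq => rw [mul_add, map_add, map_add, hp, hq, mul_add]
  | monomial n a => rw [C_mul_monomial, La_monomial, La_monomial, map_mul, mul_assoc]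

lemma La_X_mul (j : ℕ) (p : ℚ[X]) : La j (X * p) = TT (La j p) := by
  induction p using Polynomial.induction_on' with
  | add p q hp hq => rw [mul_add, map_add, map_add, map_add, hp, hq]
  | monomial n a => rw [X_mul_monomial, La_monomial, La_monomial, TT_Cmul, TT_ee]

lemma La_deriv (j : ℕ) (p : ℚ[X]) : La j (derivative p + (j : ℚ[X]) * p)
    = RatFunc.X⁻¹ * (La j p - RatFunc.C (p.eval 0)) := by
  have hj : (j : ℚ[X]) = C (j : ℚ) := by simp
  rw [hj]
  induction p using Polynomial.induction_on' with
  | add p q hp hq =>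
    rw [map_add] at hp hq
    rw [derivative_add, mul_add, eval_add]
    simp only [map_add]
    linear_combination hp + hq
  | monomial n a =>
    rw [map_add, La_Cmul, derivative_monomial, La_monomial, La_monomial, map_natCast, eval_monomial]
    cases n with
    | zero =>
      have := ee_zero j
      rw [div_eq_mul_inv] at this
      simp only [Nat.cast_zero, mul_zero, map_zero, zero_mul, pow_zero, zero_add, mul_one]
      linear_combination (RatFunc.C a) * this
    | succ k =>
      have := ee_succ j k
      rw [div_eq_mul_inv] at this
      rw [map_mul, map_natCast, Nat.add_sub_cancel, zero_pow (Nat.succ_ne_zero k), mul_zero, map_zero]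
      push_cast
      linear_combination (RatFunc.C a) * this

/-- `TT (X⁻¹ (f - c)) = Td f` -/
lemma TT_inv (f : FF) (c : ℚ) : TT (RatFunc.X⁻¹ * (f - RatFunc.C c)) = Td f := by
  rw [TT_apply, mul_inv_cancel_left₀ X_ne, Td_apply]
  have := rd_add (f - RatFunc.C c) (RatFunc.C c)
  rw [sub_add_cancel, rd_C, add_zero] at this
  rw [this]

/-- regularity at a point -/
def Reg (a : ℚ) (f : FF) : Prop := ∃ p q : ℚ[X], q.eval a ≠ 0 ∧ f * al q = al p

lemma Reg.add {a : ℚ} {f g : FF} (hf : Reg a f) (hg : Reg a g) : Reg a (f + g) := by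
  obtain ⟨p, q, hq, h⟩ := hf
  obtain ⟨p', q', hq', h'⟩ := hg
  refine ⟨p * q' + p' * q, q * q', by rw [eval_mul]; exact mul_ne_zero hq hq', ?_⟩
  rw [map_mul, map_add, map_mul, map_mul, ← h, ← h']; ring

lemma Reg.Cmul {a : ℚ} {f : FF} (c : ℚ) (hf : Reg a f) : Reg a (RatFunc.C c * f) := by
  obtain ⟨p, q, hq, h⟩ := hf
  refine ⟨C c * p, q, hq, ?_⟩
  rw [mul_assoc, h, map_mul, RatFunc.algebraMap_C]

lemma Reg.zero (a : ℚ) : Reg a 0 := ⟨0, 1, by simp, by simp⟩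

lemma Reg.sum {a : ℚ} {ι : Type*} (s : Finset ι) (f : ι → FF) (h : ∀ i ∈ s, Reg a (f i)) :
    Reg a (∑ i ∈ s, f i) :=
  Finset.sum_induction f (Reg a) (fun _ _ => Reg.add) (Reg.zero a) h

lemma Reg_ee (a : ℚ) (j k : ℕ) (h : 1 - j * a ≠ 0) : Reg a (ee j k) := by
  refine ⟨(k.factorial : ℚ[X]) * X ^ k, lj j ^ (k + 1), ?_, ?_⟩
  · rw [eval_pow]; exact pow_ne_zero _ (by simpa [lj] using h)
  · have hl := al_ne (lj_ne j)
    rw [ee, map_pow, div_mul_cancel₀ _ (pow_ne_zero _ hl)]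
    simp

lemma Reg_La (a : ℚ) (j : ℕ) (h : 1 - j * a ≠ 0) (p : ℚ[X]) : Reg a (La j p) := by
  induction p using Polynomial.induction_on' with
  | add p q hp hq => rw [map_add]; exact hp.add hq
  | monomial n c => rw [La_monomial]; exact (Reg_ee a j n h).Cmul _

lemma denom_iff (a : ℚ) (f : FF) : f.denom.eval a = 0 ↔ ¬ Reg a f := by
  constructor
  · rintro h ⟨p, q, hq, hpq⟩
    have hq0 : q ≠ 0 := by rintro rfl; simp at hq
    have : f.denom ∣ q := (RatFunc.denom_dvd hq0).2 ⟨p, (eq_div_iff (al_ne hq0)).2 hpq⟩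
    obtain ⟨r, rfl⟩ := this
    rw [eval_mul, h, zero_mul] at hq
    exact hq rfl
  · intro h
    by_contra h1
    exact h ⟨f.num, f.denom, h1,
      (eq_div_iff (al_ne f.denom_ne_zero)).1 (RatFunc.num_div_denom f).symm⟩

lemma not_Reg_ee (m : ℕ) (hm : 1 ≤ m) : ¬ Reg ((1 : ℚ) / m) (ee m 0) := by
  rintro ⟨p, q, hq, h⟩
  have hl := al_ne (lj_ne m)
  rw [ee] at h
  simp only [Nat.factorial_zero, Nat.cast_one, pow_zero, zero_add, pow_one, one_mul] at h
  rw [div_mul_eq_mul_div, div_eq_iff hl, one_mul, ← map_mul] at h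
  have h2 := RatFunc.algebraMap_injective ℚ h
  rw [h2, eval_mul] at hq
  apply hq
  have : (m : ℚ) ≠ 0 := by positivity
  simp [lj, this]

end QP

namespace QP

open PowerSeries (constantCoeff)

/-- coefficientwise application of an additive map -/
def cw {R S : Type*} [CommRing R] [CommRing S] (L : R →+ S) (f : PowerSeries R) : PowerSeries S :=
  PowerSeries.mk fun n => L (PowerSeries.coeff n f)

section cwsec
variable {R S : Type*} [CommRing R] [CommRing S] (L : R →+ S)

lemma coeff_cw (n : ℕ) (f : PowerSeries R) :
    PowerSeries.coeff n (cw L f) = L (PowerSeries.coeff n f) := PowerSeries.coeff_mk _ _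

lemma cw_add (f g : PowerSeries R) : cw L (f + g) = cw L f + cw L g := by
  ext n; simp only [coeff_cw, map_add]

lemma cw_sub (f g : PowerSeries R) : cw L (f - g) = cw L f - cw L g := by
  ext n; simp only [coeff_cw, map_sub]

lemma cw_zero : cw L (0 : PowerSeries R) = 0 := by
  ext n; simp only [coeff_cw, map_zero]

lemma cw_mul (α : ℚ →+* R) (β : ℚ →+* S) (h : ∀ c r, L (α c * r) = β c * L r)
    (a : PowerSeries ℚ) (f : PowerSeries R) :
    cw L (PowerSeries.map α a * f) = PowerSeries.map β a * cw L f := by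
  ext n
  simp only [coeff_cw, PowerSeries.coeff_mul, map_sum, PowerSeries.coeff_map, h]

lemma cw_dl (f : PowerSeries R) : cw L (dl f) = dl (cw L f) := by
  ext n
  simp only [coeff_cw, coeff_dl]
  rw [← nsmul_eq_mul, map_nsmul, nsmul_eq_mul]

end cwsec

abbrev PF := PowerSeries FF

def jo : PowerSeries ℚ →+* PF := PowerSeries.map RatFunc.C

def iv : PF := PowerSeries.C (RatFunc.X⁻¹)

lemma cw_jo (L : FF →+ FF) (h : ∀ c r, L (RatFunc.C c * r) = RatFunc.C c * L r)
    (a : PowerSeries ℚ) (f : PF) : cw L (jo a * f) = jo a * cw L f :=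
  cw_mul L RatFunc.C RatFunc.C h a f

lemma cwN_jo (a : PowerSeries ℚ) (f : PF) : cw NN (jo a * f) = jo a * cw NN f :=
  cw_jo NN NN_Cmul a f

lemma cwLa_io (j : ℕ) (a : PowerSeries ℚ) (f : KK) :
    cw (La j) (io a * f) = jo a * cw (La j) f :=
  cw_mul (La j) C RatFunc.C (La_Cmul j) a f

lemma cwLa_tt (j : ℕ) (f : KK) : cw (La j) (tt * f) = cw TT (cw (La j) f) := by
  ext n
  rw [coeff_cw, coeff_cw, coeff_cw, tt, PowerSeries.coeff_C_mul, La_X_mul]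

lemma cwLa_W (j : ℕ) (f : KK) : cw (La j) (pt f + (j : KK) * f) =
    iv * (cw (La j) f - jo (PowerSeries.map (Polynomial.evalRingHom 0) f)) := by
  ext n
  have : (j : KK) = PowerSeries.C (j : ℚ[X]) := by rw [map_natCast]
  rw [coeff_cw, this, map_add, coeff_pt, PowerSeries.coeff_C_mul, La_deriv, iv,
    PowerSeries.coeff_C_mul, map_sub, coeff_cw, jo, PowerSeries.coeff_map, PowerSeries.coeff_map]
  rfl

lemma cwTT_iv (g : PF) (y : PowerSeries ℚ) : cw TT (iv * (g - jo y)) = cw Td g := by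
  ext n
  rw [coeff_cw, coeff_cw, iv, PowerSeries.coeff_C_mul, map_sub, jo, PowerSeries.coeff_map, TT_inv]

lemma cwN_eq (g : PF) : 8 * cw NN g = - (8 * cw Td g) + cw TT g + 2 * cw TT (cw Td g) := by
  ext n
  have h8 : (8 : PF) = PowerSeries.C (8 : FF) := by rw [map_ofNat]
  have h2 : (2 : PF) = PowerSeries.C (2 : FF) := by rw [map_ofNat]
  rw [h8, h2]
  simp only [map_add, map_neg, PowerSeries.coeff_C_mul, coeff_cw, NN_apply]
  have e1 : (8 : FF) * RatFunc.C (1/8) = 1 := by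
    have : (8 : FF) = RatFunc.C (8 : ℚ) := by rw [map_ofNat]
    rw [this, ← map_mul]; norm_num
  have e2 : (8 : FF) * RatFunc.C (1/4) = 2 := by
    have : (8 : FF) = RatFunc.C (8 : ℚ) := by rw [map_ofNat]
    rw [this, ← map_mul]; norm_num
  linear_combination (TT (PowerSeries.coeff n g)) * e1 + TT (Td (PowerSeries.coeff n g)) * e2

/-- the operator -/
def Op (H : PF) : PF := iv * jo (TA ^ 2) * H + jo TD * cw NN H - dl H

lemma Op_add (f g : PF) : Op (f + g) = Op f + Op g := by
  simp only [Op, cw_add, dl_add]; ring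

lemma Op_zero : Op 0 = 0 := by
  have := Op_add 0 0
  rw [add_zero] at this
  exact left_eq_add.1 this

lemma Op_sub (f g : PF) : Op (f - g) = Op f - Op g := by
  have := Op_add (f - g) g
  rw [sub_add_cancel] at this
  rw [this, add_sub_cancel_right]

lemma Op_mul_of (a : PowerSeries ℚ) (h : dl a = 0) (f : PF) : Op (jo a * f) = jo a * Op f := by
  have h2 : dl (jo a) = 0 := by
    ext n
    have := congrArg (PowerSeries.coeff n) h
    rw [coeff_dl] at this
    rw [coeff_dl, jo, PowerSeries.coeff_map]
    have h3 := congrArg (RatFunc.C (K := ℚ)) this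
    rw [map_mul, map_natCast, map_zero, map_zero] at h3
    rw [h3, map_zero]
  rw [Op, Op, cwN_jo, dl_mul, h2]; ring

lemma dl_X_pow {k : Type*} [CommRing k] (j : ℕ) :
    dl ((PowerSeries.X : PowerSeries k) ^ j) = (j : PowerSeries k) * PowerSeries.X ^ j := by
  ext n
  have : (j : PowerSeries k) = PowerSeries.C (j : k) := by rw [map_natCast]
  rw [coeff_dl, this, PowerSeries.coeff_C_mul, PowerSeries.coeff_X_pow]
  split_ifs with h
  · rw [h]
  · simp

lemma jo_X : jo PowerSeries.X = PowerSeries.X := by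
  rw [jo, PowerSeries.map_X]

lemma step1_aux (TT' dG jd i G y c n1 n2 n3 j : PF) (e : TT' ^ 2 * (i * (G - y)) - jd * (8 * n1 - 2 * n2)
    + jd * n3 - j * G - dG = 0) (h : 8 * c = - (8 * n1) + n3 + 2 * n2) :
    i * TT' ^ 2 * G + 8 * jd * c - j * G - dG = i * TT' ^ 2 * y := by
  linear_combination e + jd * h

/-- Step 1. -/
lemma step1 (j : ℕ) : ∃ Y : KK, constantCoeff Y = 1 ∧
    Op (PowerSeries.X ^ j * cw (La j) Y) = iv * jo (TA ^ 2) * jo (PowerSeries.X ^ j * ph⁻¹) := by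
  obtain ⟨Y, h1, h2, h3⟩ := main_Y j
  refine ⟨Y, h1, ?_⟩
  have hy : PowerSeries.map (Polynomial.evalRingHom 0) Y = ph⁻¹ := by
    apply mul_left_cancel₀ ph_ne
    rw [h3, ph_inv]
  have e := congrArg (cw (La j)) h2
  have e1 : io TA ^ 2 * (pt Y + (j : KK) * Y) = io (TA ^ 2) * (pt Y + (j : KK) * Y) := by
    rw [map_pow]
  have e2 : io dd * (8 * tt - 2 * tt ^ 2) * (pt Y + (j : KK) * Y) =
      io (8 * dd) * (tt * (pt Y + (j : KK) * Y)) - io (2 * dd) * (tt * (tt * (pt Y + (j : KK) * Y))) := by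
    simp only [map_mul, map_ofNat]; ring
  have e3 : (j : KK) * Y = io (j : PowerSeries ℚ) * Y := by rw [map_natCast]
  rw [e1, e2, mul_assoc (io dd), e3, cw_sub, cw_sub, cw_add, cw_sub, cw_sub, cwLa_io, cwLa_io, cwLa_io,
    cwLa_io, cwLa_io, ← e3, cw_dl, cw_zero, cwLa_tt, cwLa_tt, cwLa_tt, cwLa_tt, cwLa_W, cwTT_iv, hy] at e
  generalize cw (La j) Y = G at e ⊢
  have h4 := cwN_eq G
  have key : iv * jo TA ^ 2 * G + 8 * jo dd * cw NN G - (j : PF) * G - dl G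
      = iv * jo TA ^ 2 * jo ph⁻¹ := by
    apply step1_aux _ _ _ _ _ _ _ _ _ _ _ _ h4
    rw [← e]
    simp only [map_mul, map_ofNat, map_pow, map_natCast]; ring
  have hX : (PowerSeries.X ^ j : PF) = jo (PowerSeries.X ^ j) := by rw [map_pow, jo_X]
  have hN : cw NN (PowerSeries.X ^ j * G) = PowerSeries.X ^ j * cw NN G := by
    rw [hX, cwN_jo]
  rw [Op, hN, dl_mul, dl_X_pow, TD_eq]
  simp only [map_mul, map_ofNat, map_pow, jo_X] at key ⊢
  linear_combination (PowerSeries.X ^ j) * key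

end QP

namespace QP

open PowerSeries (constantCoeff)

lemma cc_jo (f : PowerSeries ℚ) : constantCoeff (jo f) = RatFunc.C (constantCoeff f) := by
  rw [← PowerSeries.coeff_zero_eq_constantCoeff_apply, jo, PowerSeries.coeff_map,
    PowerSeries.coeff_zero_eq_constantCoeff_apply]

lemma cc_dl {k : Type*} [CommRing k] (f : PowerSeries k) : constantCoeff (dl f) = 0 := by
  rw [← PowerSeries.coeff_zero_eq_constantCoeff_apply, coeff_dl, Nat.cast_zero, zero_mul]

lemma inv_sub_ne (n : ℕ) : (RatFunc.X⁻¹ : FF) - (n : FF) ≠ 0 := by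
  intro h
  have hl := al_ne (lj_ne n)
  rw [al_lj] at hl
  apply hl
  have hX := X_ne
  have : (RatFunc.X : FF) * (RatFunc.X⁻¹ - (n : FF)) = 1 - (n : FF) * RatFunc.X := by
    rw [mul_sub, mul_inv_cancel₀ hX, mul_comm]
  rw [← this, h, mul_zero]

lemma uniq (M : ℕ) (Z : PF) (h : (PowerSeries.X : PF) ^ M ∣ Op Z) :
    ∀ n, n ≤ M → (PowerSeries.X : PF) ^ n ∣ Z := by
  intro n
  induction n with
  | zero => intro _; rw [pow_zero]; exact one_dvd _
  | succ n ih =>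
    intro hn
    obtain ⟨W, rfl⟩ := ih (by omega)
    have hX : (PowerSeries.X ^ n : PF) = jo (PowerSeries.X ^ n) := by rw [map_pow, jo_X]
    have hN : cw NN (PowerSeries.X ^ n * W) = PowerSeries.X ^ n * cw NN W := by
      rw [hX, cwN_jo]
    have hO : Op (PowerSeries.X ^ n * W) = PowerSeries.X ^ n *
        (iv * jo (TA ^ 2) * W + jo TD * cw NN W - (n : PF) * W - dl W) := by
      rw [Op, hN, dl_mul, dl_X_pow]; ring
    have h1 : (PowerSeries.X : PF) ^ (n + 1) ∣ Op (PowerSeries.X ^ n * W) :=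
      (pow_dvd_pow _ hn).trans h
    rw [hO, pow_succ] at h1
    have h2 := (mul_dvd_mul_iff_left (pow_ne_zero n PowerSeries.X_ne_zero)).1 h1
    rw [PowerSeries.X_dvd_iff] at h2
    simp only [map_add, map_sub, map_mul, cc_jo, cc_dl, map_pow, cc_TA, cc_TD, map_one, map_zero, iv,
      PowerSeries.constantCoeff_C, map_natCast, one_pow, zero_mul, add_zero, sub_zero, mul_one] at h2
    rw [← sub_mul] at h2
    have h3 := (mul_eq_zero.1 h2).resolve_left (inv_sub_ne n)
    rw [pow_succ]
    exact mul_dvd_mul_left _ (PowerSeries.X_dvd_iff.2 h3)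

lemma dl_xx_pow (m : ℕ) : dl (xx ^ m) = (m : PowerSeries ℚ) * xx ^ m * TB ^ 2 := by
  induction m with
  | zero => rw [pow_zero, dl_one]; simp
  | succ m ih => rw [pow_succ, dl_mul, ih, dlxx]; push_cast; ring

lemma dl_jo (f : PowerSeries ℚ) : dl (jo f) = jo (dl f) := dl_map _ _

lemma cwN_C (q : FF) : cw NN (PowerSeries.C q) = PowerSeries.C (NN q) := by
  ext n
  rw [coeff_cw, PowerSeries.coeff_C, PowerSeries.coeff_C]
  split_ifs
  · rfl
  · exact map_zero _

lemma Op_term (q : FF) (m : ℕ) : Op (jo (xx ^ m) * PowerSeries.C q) =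
    jo (TA ^ 2) * (iv * PowerSeries.C q * jo xx ^ m + jo xx ^ (m + 1) * PowerSeries.C (NN q)
      - (m : PF) * PowerSeries.C q * jo xx ^ m + (m : PF) * PowerSeries.C q * jo xx ^ (m + 1)) := by
  have hTB : jo TB ^ 2 = jo TA ^ 2 - jo TD := by
    rw [← map_pow, ← map_pow, ← map_sub, TD]; congr 1; ring
  have hD : jo TD = jo xx * jo TA ^ 2 := by rw [← xxA, map_mul, map_pow]
  rw [Op, cwN_jo, cwN_C, dl_mul, dl_C, dl_jo, dl_xx_pow]
  simp only [map_mul, map_pow, map_natCast]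
  rw [hTB, hD]
  ring

def QS (Q : ℕ → FF) (N : ℕ) : PF :=
  ∑ m ∈ Finset.range (N + 1), jo (xx ^ m) * PowerSeries.C (Q m)

lemma Op_QS (Q : ℕ → FF) (h0 : RatFunc.X⁻¹ * Q 0 = RatFunc.X⁻¹)
    (hs : ∀ m : ℕ, RatFunc.X⁻¹ * Q (m + 1) = ((m : FF) + 1) * Q (m + 1) - (m : FF) * Q m - NN (Q m))
    (N : ℕ) : Op (QS Q N) = jo (TA ^ 2) *
      (iv + jo xx ^ (N + 1) * (PowerSeries.C (NN (Q N)) + (N : PF) * PowerSeries.C (Q N))) := by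
  induction N with
  | zero =>
    have e : iv * PowerSeries.C (Q 0) = iv := by rw [iv, ← map_mul, h0]
    rw [QS, Finset.sum_range_one, Op_term, e]
    push_cast
    ring
  | succ N ih =>
    rw [QS, Finset.sum_range_succ, Op_add, ← QS, ih, Op_term]
    have e : iv * PowerSeries.C (Q (N + 1)) = ((N : PF) + 1) * PowerSeries.C (Q (N + 1))
        - (N : PF) * PowerSeries.C (Q N) - PowerSeries.C (NN (Q N)) := by
      rw [iv, ← map_mul, hs]
      simp only [map_sub, map_mul, map_add, map_natCast, map_one]
    rw [e]
    push_cast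
    ring

def GS (Y : ℕ → KK) (N : ℕ) : PF :=
  ∑ j ∈ Finset.range (N + 1), jo (PowerSeries.C (PowerSeries.coeff j ph)) *
    (PowerSeries.X ^ j * cw (La j) (Y j))

def PS (N : ℕ) : PowerSeries ℚ :=
  ∑ j ∈ Finset.range (N + 1), PowerSeries.C (PowerSeries.coeff j ph) * PowerSeries.X ^ j

lemma PS_dvd (N : ℕ) : (PowerSeries.X : PowerSeries ℚ) ^ (N + 1) ∣ PS N - ph := by
  rw [PowerSeries.X_pow_dvd_iff]
  intro m hm
  rw [map_sub, PS, map_sum, sub_eq_zero]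
  simp only [PowerSeries.coeff_C_mul, PowerSeries.coeff_X_pow, mul_ite, mul_one, mul_zero]
  rw [Finset.sum_ite_eq, if_pos (Finset.mem_range.2 hm)]

lemma Op_GS (Y : ℕ → KK) (hY : ∀ j, Op (PowerSeries.X ^ j * cw (La j) (Y j)) =
      iv * jo (TA ^ 2) * jo (PowerSeries.X ^ j * ph⁻¹)) (N : ℕ) :
    Op (GS Y N) = iv * jo (TA ^ 2) * jo (PS N * ph⁻¹) := by
  induction N with
  | zero =>
    rw [GS, PS, Finset.sum_range_one, Finset.sum_range_one, Op_mul_of _ (dl_C _), hY]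
    simp only [map_mul]; ring
  | succ N ih =>
    have g1 : GS Y (N + 1) = GS Y N + jo (PowerSeries.C (PowerSeries.coeff (N + 1) ph)) *
        (PowerSeries.X ^ (N + 1) * cw (La (N + 1)) (Y (N + 1))) := Finset.sum_range_succ _ _
    have g2 : PS (N + 1) = PS N + PowerSeries.C (PowerSeries.coeff (N + 1) ph) *
        PowerSeries.X ^ (N + 1) := Finset.sum_range_succ _ _
    rw [g1, g2, Op_add, ih, Op_mul_of _ (dl_C _), hY, add_mul]
    simp only [map_mul, map_add]; ring

lemma key_eq (Q : ℕ → FF) (h0 : RatFunc.X⁻¹ * Q 0 = RatFunc.X⁻¹)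
    (hs : ∀ m : ℕ, RatFunc.X⁻¹ * Q (m + 1) = ((m : FF) + 1) * Q (m + 1) - (m : FF) * Q m - NN (Q m))
    (Y : ℕ → KK) (hY : ∀ j, Op (PowerSeries.X ^ j * cw (La j) (Y j)) =
      iv * jo (TA ^ 2) * jo (PowerSeries.X ^ j * ph⁻¹)) (N : ℕ) :
    PowerSeries.coeff N (QS Q N) = PowerSeries.coeff N (GS Y N) := by
  have hd : (PowerSeries.X : PF) ^ (N + 1) ∣ Op (QS Q N - GS Y N) := by
    rw [Op_sub, Op_QS Q h0 hs, Op_GS Y hY]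
    have e1 : jo (PS N * ph⁻¹) = 1 + jo (PS N - ph) * jo ph⁻¹ := by
      have : PS N * ph⁻¹ = 1 + (PS N - ph) * ph⁻¹ := by
        rw [sub_mul, ph_inv]; ring
      rw [this, map_add, map_one, map_mul]
    have e2 : (PowerSeries.X : PF) ^ (N + 1) ∣ jo xx ^ (N + 1) := by
      apply pow_dvd_pow_of_dvd
      rw [PowerSeries.X_dvd_iff, cc_jo, cc_xx, map_zero]
    have e3 : (PowerSeries.X : PF) ^ (N + 1) ∣ jo (PS N - ph) := by
      have := map_dvd jo (PS_dvd N)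
      rwa [map_pow, jo_X] at this
    rw [e1]
    have e4 := (e2.mul_right (jo (TA ^ 2) * (PowerSeries.C (NN (Q N)) + (N : PF) * PowerSeries.C (Q N)))).sub
      (e3.mul_right (iv * jo (TA ^ 2) * jo ph⁻¹))
    convert e4 using 1
    ring
  have := uniq _ _ hd (N + 1) le_rfl
  rw [PowerSeries.X_pow_dvd_iff] at this
  have h := this N (Nat.lt_succ_self N)
  rwa [map_sub, sub_eq_zero] at h

lemma coeff_xx_pow (N : ℕ) : PowerSeries.coeff N (xx ^ N) = 16 ^ N := by
  obtain ⟨u, hu⟩ := PowerSeries.X_dvd_iff.2 cc_xx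
  have h1 := c1_xx
  rw [hu, ← zero_add 1, PowerSeries.coeff_succ_X_mul, PowerSeries.coeff_zero_eq_constantCoeff_apply] at h1
  rw [hu, mul_pow, PowerSeries.coeff_X_pow_mul', if_pos le_rfl, Nat.sub_self,
    PowerSeries.coeff_zero_eq_constantCoeff_apply, map_pow, h1]

lemma coeff_QS (Q : ℕ → FF) (N : ℕ) : PowerSeries.coeff N (QS Q N) =
    (∑ m ∈ Finset.range N, RatFunc.C (PowerSeries.coeff N (xx ^ m)) * Q m) + RatFunc.C (16 ^ N) * Q N := by
  rw [QS, map_sum]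
  simp only [PowerSeries.coeff_mul_C, jo, PowerSeries.coeff_map]
  rw [Finset.sum_range_succ, coeff_xx_pow]

lemma coeff_GS (Y : ℕ → KK) (h1 : ∀ j, constantCoeff (Y j) = 1) (N : ℕ) : PowerSeries.coeff N (GS Y N) =
    (∑ j ∈ Finset.range N, RatFunc.C (PowerSeries.coeff j ph) * La j (PowerSeries.coeff (N - j) (Y j)))
      + RatFunc.C (PowerSeries.coeff N ph) * ee N 0 := by
  have hc : ∀ c : ℚ, jo (PowerSeries.C c) = PowerSeries.C (RatFunc.C c) := fun c => by
    rw [jo, PowerSeries.map_C]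
  rw [GS, map_sum]
  simp only [hc, PowerSeries.coeff_C_mul, PowerSeries.coeff_X_pow_mul', coeff_cw]
  rw [Finset.sum_range_succ, if_pos le_rfl, Nat.sub_self, PowerSeries.coeff_zero_eq_constantCoeff_apply, h1]
  have : La N 1 = ee N 0 := by
    have := La_monomial N 0 1
    rwa [Polynomial.monomial_zero_one, map_one RatFunc.C, one_mul] at this
  rw [this]
  congr 1
  apply Finset.sum_congr rfl
  intro j hj
  rw [if_pos (Finset.mem_range.1 hj).le]

lemma Reg_Cmul_iff {a : ℚ} {f : FF} (c : ℚ) (hc : c ≠ 0) : Reg a (RatFunc.C c * f) ↔ Reg a f := by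
  refine ⟨fun h => ?_, fun h => h.Cmul c⟩
  have := h.Cmul c⁻¹
  rwa [← mul_assoc, ← map_mul, inv_mul_cancel₀ hc, map_one, one_mul] at this

lemma Reg_add_iff {a : ℚ} {f g : FF} (hf : Reg a f) : Reg a (f + g) ↔ Reg a g := by
  refine ⟨fun h => ?_, fun h => hf.add h⟩
  have := h.add (hf.Cmul (-1))
  have e : f + g + RatFunc.C (-1) * f = g := by
    rw [map_neg, map_one]; ring
  rwa [e] at this

lemma main_reg (Q : ℕ → FF) (h0 : RatFunc.X⁻¹ * Q 0 = RatFunc.X⁻¹)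
    (hs : ∀ m : ℕ, RatFunc.X⁻¹ * Q (m + 1) = ((m : FF) + 1) * Q (m + 1) - (m : FF) * Q m - NN (Q m))
    (a : ℚ) (N : ℕ) (ha : ∀ j < N, 1 - (j : ℚ) * a ≠ 0) :
    Reg a (Q N) ↔ Reg a (RatFunc.C (PowerSeries.coeff N ph) * ee N 0) := by
  choose Y hY1 hY using step1
  induction N using Nat.strong_induction_on with
  | _ N ih =>
    have h := key_eq Q h0 hs Y hY N
    rw [coeff_QS, coeff_GS Y hY1] at h
    have r1 : Reg a (∑ m ∈ Finset.range N, RatFunc.C (PowerSeries.coeff N (xx ^ m)) * Q m) := by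
      refine Reg.sum _ _ fun m hm => ?_
      have hm := Finset.mem_range.1 hm
      refine Reg.Cmul _ ((ih m hm fun j hj => ha j (hj.trans hm)).2 ?_)
      exact (Reg_ee a m 0 (ha m hm)).Cmul _
    have r2 : Reg a (∑ j ∈ Finset.range N, RatFunc.C (PowerSeries.coeff j ph) *
        La j (PowerSeries.coeff (N - j) (Y j))) :=
      Reg.sum _ _ fun m hm => (Reg_La a m (ha m (Finset.mem_range.1 hm)) _).Cmul _
    have e := Reg_add_iff (g := RatFunc.C (PowerSeries.coeff N ph) * ee N 0) r2
    rw [← e, ← h, Reg_add_iff r1, Reg_Cmul_iff _ (by positivity)]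

lemma final (Q : ℕ → FF) (h0 : RatFunc.X⁻¹ * Q 0 = RatFunc.X⁻¹)
    (hs : ∀ m : ℕ, RatFunc.X⁻¹ * Q (m + 1) = ((m : FF) + 1) * Q (m + 1) - (m : FF) * Q m - NN (Q m))
    (m : ℕ) (hm : 1 ≤ m) :
    (Q m).denom.eval ((1 : ℚ) / m) = 0 ↔ ∃ k : ℤ, (m : ℤ) = k ^ 2 := by
  have hm0 : (m : ℚ) ≠ 0 := by positivity
  rw [denom_iff, main_reg Q h0 hs _ m, ← coeff_ph_ne_zero_iff]
  · constructor
    · intro h h2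
      apply h
      rw [h2, map_zero, zero_mul]
      exact Reg.zero _
    · intro h
      rw [Reg_Cmul_iff _ h]
      exact not_Reg_ee m hm
  · intro j hj h
    field_simp at h
    have : (j : ℚ) < m := by exact_mod_cast hj
    linarith

end QP

/-- For every `m ≥ 1`, the rational function `Q m` has a pole at `v = 1/m`
(i.e. the denominator of its reduced form vanishes at `1/m`) if and only if `m` is a
perfect square. -/
theorem Q_pole_iff_square
    (Q : ℕ → RatFunc ℚ)
    (hQrec : ∀ m : ℕ,
      Q m / RatFunc.X - (m : ℚ) • Q m
        + ((m : ℚ) - 1) • (if m = 0 then 0 else Q (m - 1))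
        - RatFunc.X * ratDeriv (if m = 0 then 0 else Q (m - 1))
        - (1/8 : ℚ) • (RatFunc.X * ratDeriv (RatFunc.X * (if m = 0 then 0 else Q (m - 1))))
        + (1/4 : ℚ) • (RatFunc.X * ratDeriv (RatFunc.X *
            ratDeriv (RatFunc.X * (if m = 0 then 0 else Q (m - 1)))))
      = (if m = 0 then 1 else 0) / RatFunc.X)
    (m : ℕ) (hm : 1 ≤ m) :
    (Q m).denom.eval ((1 : ℚ) / m) = 0 ↔ ∃ k : ℤ, (m : ℤ) = k ^ 2 := by
  have hC : ∀ (c : ℚ) (f : RatFunc ℚ), c • f = RatFunc.C c * f := fun c f => RatFunc.smul_eq_C_mul c f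
  apply QP.final Q _ _ m hm
  · have h := hQrec 0
    simp only [if_true, hC] at h
    have hz : ratDeriv (0 : RatFunc ℚ) = 0 := by
      have := QP.rd_C 0
      rwa [map_zero] at this
    simp only [hz, mul_zero, Nat.cast_zero, map_zero, zero_mul, sub_zero, add_zero] at h
    rw [one_div, div_eq_mul_inv, mul_comm] at h
    exact h
  · intro n
    have h := hQrec (n + 1)
    simp only [Nat.succ_ne_zero, if_false, hC, Nat.add_sub_cancel, zero_div] at h
    rw [QP.NN_rec]
    rw [div_eq_mul_inv] at h
    simp only [Nat.cast_add, Nat.cast_one, add_sub_cancel_right, map_add, map_natCast, map_one] at h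
    linear_combination h
end
end

section
/- For every real number K ≥ 2 there exists a constant B > 0 (depending only on K, a, b, w) such that for every integer m ≥ K² + aK and every integer i ≥ 0, the i-th Taylor coefficient e_{mi} of e_m at v = 0 satisfies |e_{mi}| ≤ B·K^{3m}·(m/K)^{2i}. -/
open Polynomial

noncomputable section

/-- embedding of rational functions in Laurent series -/
def phi : RatFunc ℚ →+* LaurentSeries ℚ :=
  @algebraMap (RatFunc ℚ) (LaurentSeries ℚ) _ _ (RatFunc.liftAlgebra ℚ (LaurentSeries ℚ))

lemma phi_coe (f : RatFunc ℚ) : (f : LaurentSeries ℚ) = phi f := rfl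

/-- embedding of power series in Laurent series -/
def iot : PowerSeries ℚ →+* LaurentSeries ℚ := HahnSeries.ofPowerSeries ℤ ℚ

lemma iot_inj : Function.Injective iot := HahnSeries.ofPowerSeries_injective

lemma phi_poly (p : ℚ[X]) : phi (algebraMap ℚ[X] (RatFunc ℚ) p) = iot (p : PowerSeries ℚ) :=
  (RatFunc.coe_coe p).symm

lemma phi_X : phi RatFunc.X = iot PowerSeries.X := by
  rw [← RatFunc.algebraMap_X, phi_poly, Polynomial.coe_X]

lemma phi_smul (c : ℚ) (f : RatFunc ℚ) : phi (c • f) = iot (PowerSeries.C c) * phi f := by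
  rw [RatFunc.smul_eq_C_mul, map_mul, ← RatFunc.algebraMap_C, phi_poly, Polynomial.coe_C]

lemma phi_deriv (f : RatFunc ℚ) (g : PowerSeries ℚ) (h : phi f = iot g) :
    phi (ratDeriv f) = iot (PowerSeries.derivative ℚ g) := by
  have hd : f.denom ≠ 0 := RatFunc.denom_ne_zero f
  have hd' : iot (f.denom : PowerSeries ℚ) ≠ 0 := by
    rw [Ne, map_eq_zero_iff _ iot_inj, Polynomial.coe_eq_zero_iff]; exact hd
  have h1 : g * (f.denom : PowerSeries ℚ) = (f.num : PowerSeries ℚ) := by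
    apply iot_inj
    rw [map_mul, ← h, ← phi_poly, ← phi_poly, ← map_mul]
    congr 1
    conv_lhs => rw [← RatFunc.num_div_denom f]
    rw [RatFunc.num_div_denom f]
    nth_rewrite 1 [← RatFunc.num_div_denom f]
    field_simp [RatFunc.algebraMap_ne_zero hd]
  have h2 := congrArg (PowerSeries.derivative ℚ) h1
  rw [Derivation.leibniz, PowerSeries.derivative_coe, PowerSeries.derivative_coe] at h2
  simp only [smul_eq_mul] at h2
  rw [ratDeriv, RatFunc.mk_eq_div, map_div₀, phi_poly, phi_poly, div_eq_iff, ← map_mul]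
  · congr 1
    push_cast
    rw [← h2, ← h1]
    ring
  · push_cast
    rw [map_pow]
    exact pow_ne_zero _ hd'

lemma step (q r s : ℚ) (t : ℚ) (f f' : RatFunc ℚ) (g : PowerSeries ℚ) (h : phi f' = iot g)
    (hr : f / RatFunc.X - q • f + r • f' - RatFunc.X * ratDeriv f'
        + s • (RatFunc.X * ratDeriv (RatFunc.X * f'))
        + (1/4 : ℚ) • (RatFunc.X * ratDeriv (RatFunc.X * ratDeriv (RatFunc.X * f')))
      = (algebraMap _ _ (Polynomial.C t)) / RatFunc.X) :
    ∃ G : PowerSeries ℚ, phi f = iot G ∧ PowerSeries.coeff 0 G = t ∧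
      ∀ i : ℕ, PowerSeries.coeff (i+1) G = q * PowerSeries.coeff i G
        + (i - r) * PowerSeries.coeff i g
        - (i * (i + 4 * s) / 4) * PowerSeries.coeff (i-1) g := by
  set X' : PowerSeries ℚ := PowerSeries.X with hX'
  set D := PowerSeries.derivative ℚ
  have e1 : phi (RatFunc.X * f') = iot (X' * g) := by rw [map_mul, map_mul, phi_X, h]
  have e2 := phi_deriv _ _ e1
  have e3 : phi (RatFunc.X * ratDeriv (RatFunc.X * f')) = iot (X' * D (X' * g)) := by
    rw [map_mul, map_mul, phi_X, e2]
  have e4 : phi (ratDeriv (RatFunc.X * ratDeriv (RatFunc.X * f'))) = iot (D (X' * D (X' * g))) :=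
    phi_deriv _ _ e3
  have e5 : phi (ratDeriv f') = iot (D g) := phi_deriv _ _ h
  have hX : iot X' ≠ 0 := by
    rw [Ne, map_eq_zero_iff _ iot_inj]; exact PowerSeries.X_ne_zero
  have hr2 := congrArg phi hr
  simp only [map_add, map_sub, map_div₀, phi_smul, phi_poly, Polynomial.coe_C] at hr2
  rw [e3, map_mul phi, map_mul phi, e4, e5, phi_X, h, ← hX'] at hr2
  set S : PowerSeries ℚ := PowerSeries.C r * g - X' * D g
    + PowerSeries.C s * (X' * D (X' * g)) + PowerSeries.C (1/4) * (X' * D (X' * D (X' * g))) with hS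
  have hr3 : phi f * iot (1 - PowerSeries.C q * X') = iot (PowerSeries.C t - X' * S) := by
    simp only [hS, map_add, map_sub, map_mul, map_one] at hr2 ⊢
    field_simp at hr2
    linear_combination hr2
  set Q : PowerSeries ℚ := 1 - PowerSeries.C q * X' with hQ
  have hQ0 : PowerSeries.constantCoeff Q ≠ 0 := by simp [hQ, hX']
  have hQi : Q * Q⁻¹ = 1 := PowerSeries.mul_inv_cancel _ hQ0
  have hG : phi f = iot ((PowerSeries.C t - X' * S) * Q⁻¹) := by
    rw [map_mul, ← hr3, mul_assoc, ← map_mul, hQi, map_one, mul_one]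
  refine ⟨_, hG, ?_⟩
  set G := (PowerSeries.C t - X' * S) * Q⁻¹ with hGd
  have hGQ : G = PowerSeries.C t + PowerSeries.C q * (X' * G) - X' * S := by
    have : G * Q = PowerSeries.C t - X' * S := by
      rw [hGd, mul_assoc, mul_comm Q⁻¹, hQi, mul_one]
    rw [hQ] at this
    linear_combination this
  constructor
  · rw [hGQ]; simp [hX']
  · intro i
    conv_lhs => rw [hGQ]
    cases i with
    | zero =>
      have c0 : ∀ F : PowerSeries ℚ, PowerSeries.coeff 0 (X' * F) = 0 := by
        intro F; rw [hX', PowerSeries.coeff_zero_X_mul]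
      simp only [map_add, map_sub, PowerSeries.coeff_C_mul, hS]
      rw [hX', PowerSeries.coeff_succ_X_mul, PowerSeries.coeff_succ_X_mul, ← hX']
      simp only [map_add, map_sub, PowerSeries.coeff_C_mul, c0, PowerSeries.coeff_C]
      simp
      ring
    | succ j =>
      have c1 : ∀ (F : PowerSeries ℚ) (n : ℕ), PowerSeries.coeff (n+1) (X' * D F) = (n+1) * PowerSeries.coeff (n+1) F := by
        intro F n
        rw [hX', PowerSeries.coeff_succ_X_mul, PowerSeries.coeff_derivative]; ring
      simp only [map_add, map_sub, PowerSeries.coeff_C_mul, hS]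
      rw [hX', PowerSeries.coeff_succ_X_mul, PowerSeries.coeff_succ_X_mul, ← hX']
      simp only [map_add, map_sub, PowerSeries.coeff_C_mul, c1, PowerSeries.coeff_C]
      rw [hX', PowerSeries.coeff_succ_X_mul]
      simp
      ring

lemma bridge     (a b4 c4 : ℕ) 
    (e : ℕ → RatFunc ℚ)
    (herec : ∀ m : ℕ,
      e m / RatFunc.X - ((m : ℚ) + a) • e m
        + ((m : ℚ) - 1 - b4 / 4) • (if m = 0 then 0 else e (m - 1))
        - RatFunc.X * ratDeriv (if m = 0 then 0 else e (m - 1))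
        + (((2 * (a : ℚ) + b4 / 2 + c4 / 2) - 1) / 4) •
            (RatFunc.X * ratDeriv (RatFunc.X * (if m = 0 then 0 else e (m - 1))))
        + (1/4 : ℚ) • (RatFunc.X * ratDeriv (RatFunc.X *
            ratDeriv (RatFunc.X * (if m = 0 then 0 else e (m - 1)))))
      = (if m = 0 then 1 else 0) / RatFunc.X) :
    ∃ G : ℕ → PowerSeries ℚ, (∀ m, phi (e m) = iot (G m)) ∧
      PowerSeries.coeff 0 (G 0) = 1 ∧ (∀ i, PowerSeries.coeff (i+1) (G 0) = a * PowerSeries.coeff i (G 0)) ∧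
      (∀ m, PowerSeries.coeff 0 (G (m+1)) = 0) ∧
      (∀ m i : ℕ, PowerSeries.coeff (i+1) (G (m+1)) = (m + 1 + a) * PowerSeries.coeff i (G (m+1))
        + (i - m + b4/4) * PowerSeries.coeff i (G m)
        - (i * (i - 1 + (2 * (a : ℚ) + b4 / 2 + c4 / 2)) / 4) * PowerSeries.coeff (i-1) (G m)) := by
  have h0 : ∃ G : PowerSeries ℚ, phi (e 0) = iot G ∧ PowerSeries.coeff 0 G = 1 ∧
      ∀ i : ℕ, PowerSeries.coeff (i+1) G = a * PowerSeries.coeff i G := by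
    have := herec 0
    simp only [if_true] at this
    obtain ⟨G, h1, h2, h3⟩ := step _ _ _ 1 _ _ 0 (by rw [map_zero, map_zero]) (by rw [this]; simp)
    refine ⟨G, h1, h2, fun i => ?_⟩
    rw [h3]; simp
  have hs : ∀ m (g : PowerSeries ℚ), phi (e m) = iot g → ∃ G : PowerSeries ℚ, phi (e (m+1)) = iot G ∧
      PowerSeries.coeff 0 G = 0 ∧
      ∀ i : ℕ, PowerSeries.coeff (i+1) G = (m + 1 + a) * PowerSeries.coeff i G
        + (i - m + b4/4) * PowerSeries.coeff i g
        - (i * (i - 1 + (2 * (a : ℚ) + b4 / 2 + c4 / 2)) / 4) * PowerSeries.coeff (i-1) g := by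
    intro m g hg
    have := herec (m+1)
    simp only [Nat.succ_ne_zero, if_false, Nat.add_sub_cancel] at this
    obtain ⟨G, h1, h2, h3⟩ := step _ _ _ 0 _ _ g hg (by rw [this]; simp)
    refine ⟨G, h1, h2, fun i => ?_⟩
    rw [h3]; push_cast; ring
  have hall : ∀ m, ∃ g, phi (e m) = iot g := by
    intro m
    induction m with
    | zero => exact ⟨_, h0.choose_spec.1⟩
    | succ m ih => obtain ⟨g, hg⟩ := ih; obtain ⟨G, h, _⟩ := hs m g hg; exact ⟨G, h⟩
  choose G hG using hall
  refine ⟨G, hG, ?_, ?_, ?_, ?_⟩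
  · obtain ⟨g, h1, h2, h3⟩ := h0
    rw [iot_inj ((hG 0).symm.trans h1)]; exact h2
  · obtain ⟨g, h1, h2, h3⟩ := h0
    rw [iot_inj ((hG 0).symm.trans h1)]; exact h3
  · intro m
    obtain ⟨g, h1, h2, h3⟩ := hs m _ (hG m)
    rw [iot_inj ((hG (m+1)).symm.trans h1)]; exact h2
  · intro m
    obtain ⟨g, h1, h2, h3⟩ := hs m _ (hG m)
    rw [iot_inj ((hG (m+1)).symm.trans h1)]; exact h3

lemma coeff_iot (g : PowerSeries ℚ) (i : ℕ) : (iot g).coeff (i : ℤ) = PowerSeries.coeff i g :=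
  HahnSeries.ofPowerSeries_apply_coeff g i

lemma poly_geom (p s : ℝ) (hp : 0 ≤ p) (hps : p < s) :
    ∃ C : ℝ, 0 ≤ C ∧ ∀ i : ℕ, ((i : ℝ) + 1) ^ 2 * p ^ i ≤ C * s ^ i := by
  have hs : 0 < s := lt_of_le_of_lt hp hps
  have hr : |p / s| < 1 := by
    rw [abs_of_nonneg (by positivity), div_lt_one hs]; exact hps
  have h2 := tendsto_pow_const_mul_const_pow_of_abs_lt_one 2 hr
  obtain ⟨A, hA⟩ := h2.bddAbove_range
  have hA' : ∀ i : ℕ, (i : ℝ) ^ 2 * (p / s) ^ i ≤ A := fun i => hA ⟨i, rfl⟩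
  have hA0 : 0 ≤ A := by simpa using hA' 0
  refine ⟨4 * A + 1, by positivity, fun i => ?_⟩
  have hd : p ^ i = (p / s) ^ i * s ^ i := by rw [← mul_pow, div_mul_cancel₀ _ hs.ne']
  rw [hd, ← mul_assoc]
  apply mul_le_mul_of_nonneg_right _ (by positivity)
  rcases Nat.eq_zero_or_pos i with rfl | hi
  · simp; positivity
  · have h1 : (1 : ℝ) ≤ i := by exact_mod_cast hi
    have h3 : ((i : ℝ) + 1) ^ 2 ≤ 4 * (i : ℝ) ^ 2 := by nlinarith
    have h4 : 0 ≤ (p / s) ^ i := by positivity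
    nlinarith [hA' i, mul_le_mul_of_nonneg_right h3 h4]


lemma base_bound (a : ℕ) (b w : ℝ) (hb : 0 ≤ b) (hw : 0 ≤ w) (E : ℕ → ℕ → ℝ)
    (h00 : E 0 0 = 1) (h0 : ∀ i, E 0 (i+1) = a * E 0 i)
    (hz : ∀ m, E (m+1) 0 = 0)
    (hs : ∀ m i : ℕ, E (m+1) (i+1) = (m + 1 + a) * E (m+1) i + (i - m + b) * E m i
        - (i * (i - 1 + w) / 4) * E m (i-1))
    (m : ℕ) : ∃ C : ℝ, 0 ≤ C ∧ ∀ i, |E m i| ≤ C * ((m : ℝ) + a) ^ i := by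
  induction m with
  | zero =>
    refine ⟨1, zero_le_one, fun i => ?_⟩
    have : E 0 i = (a : ℝ) ^ i := by
      induction i with
      | zero => simpa using h00
      | succ i ih => rw [h0, ih]; ring
    rw [this, abs_of_nonneg (by positivity)]; simp
  | succ m ih =>
    obtain ⟨C, hC, h⟩ := ih
    set p : ℝ := (m : ℝ) + a with hp
    have hp0 : 0 ≤ p := by positivity
    set s : ℝ := p + 1/2 with hsdef
    have hs0 : 1/2 ≤ s := by linarith
    have hsp : 0 < s := by linarith
    obtain ⟨A, hA, hpg⟩ := poly_geom p s hp0 (by linarith)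
    have hE : ∀ i : ℕ, ((i : ℝ) + 1) ^ 2 * |E m i| ≤ C * A * s ^ i := by
      intro i
      calc ((i : ℝ) + 1) ^ 2 * |E m i| ≤ ((i : ℝ) + 1) ^ 2 * (C * p ^ i) := by gcongr; exact h i
        _ = C * (((i : ℝ) + 1) ^ 2 * p ^ i) := by ring
        _ ≤ C * (A * s ^ i) := mul_le_mul_of_nonneg_left (hpg i) hC
        _ = _ := by ring
    set T : ℕ → ℝ := fun i => (i - m + b) * E m i - (i * (i - 1 + w) / 4) * E m (i-1) with hT
    have hTb : ∃ L : ℝ, 0 ≤ L ∧ ∀ i, |T i| ≤ L * s ^ i := by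
      refine ⟨(1 + m + b) * (C * A) + 2 * (1 + w) * (C * A), by positivity, fun i => ?_⟩
      have t1 : |((i : ℝ) - m + b) * E m i| ≤ (1 + m + b) * (C * A) * s ^ i := by
        rw [abs_mul]
        have : |(i : ℝ) - m + b| ≤ (1 + m + b) * ((i : ℝ) + 1) ^ 2 := by
          have hi : (0 : ℝ) ≤ i := by positivity
          have hm : (0 : ℝ) ≤ m := by positivity
          have : (1 + m + b) * ((i : ℝ) + 1) ≤ (1 + m + b) * ((i : ℝ) + 1) ^ 2 := by
            gcongr; nlinarith
          have h5 : 0 ≤ (m + b) * (i : ℝ) := by positivity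
          rw [abs_le]; constructor <;> nlinarith
        calc _ ≤ (1 + m + b) * ((i : ℝ) + 1) ^ 2 * |E m i| := by gcongr
          _ = (1 + m + b) * (((i : ℝ) + 1) ^ 2 * |E m i|) := by ring
          _ ≤ (1 + m + b) * (C * A * s ^ i) := mul_le_mul_of_nonneg_left (hE i) (by positivity)
          _ = _ := by ring
      have t2 : |((i : ℝ) * (i - 1 + w) / 4) * E m (i-1)| ≤ 2 * (1 + w) * (C * A) * s ^ i := by
        cases i with
        | zero => simp; positivity
        | succ j =>
          have hj : (0 : ℝ) ≤ j := by positivity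
          rw [Nat.add_sub_cancel, abs_mul]
          push_cast
          rw [abs_of_nonneg (by apply div_nonneg (mul_nonneg (by positivity) (by linarith)); norm_num)]
          have : ((j : ℝ) + 1) * (j + 1 - 1 + w) / 4 ≤ (1 + w) * ((j : ℝ) + 1) ^ 2 := by
            have : 0 ≤ w * j := by positivity
            have : 0 ≤ w * j * j := by positivity
            nlinarith
          calc _ ≤ (1 + w) * ((j : ℝ) + 1) ^ 2 * |E m j| := by gcongr
            _ = (1 + w) * (((j : ℝ) + 1) ^ 2 * |E m j|) := by ring
            _ ≤ (1 + w) * (C * A * s ^ j) := mul_le_mul_of_nonneg_left (hE j) (by positivity)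
            _ = (1 + w) * (C * A * s ^ j) * 1 := by ring
            _ ≤ (1 + w) * (C * A * s ^ j) * (2 * s) := by gcongr; linarith
            _ = _ := by ring
      calc |T i| ≤ _ := abs_sub _ _
        _ ≤ _ := add_le_add t1 t2
        _ = _ := by ring
    obtain ⟨L, hL, hTL⟩ := hTb
    have key : ∀ i, |E (m+1) i| ≤ 2 * L * (p + 1) ^ i - 2 * L * s ^ i := by
      intro i
      induction i with
      | zero => simp [hz]
      | succ i ih =>
        have : E (m+1) (i+1) = (p + 1) * E (m+1) i + T i := by rw [hs, hT, hp]; ring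
        rw [this]
        calc _ ≤ |(p + 1) * E (m+1) i| + |T i| := abs_add_le _ _
          _ = (p + 1) * |E (m+1) i| + |T i| := by rw [abs_mul, abs_of_nonneg (by positivity : 0 ≤ p + 1)]
          _ ≤ (p + 1) * (2 * L * (p + 1) ^ i - 2 * L * s ^ i) + L * s ^ i := by gcongr; exact hTL i
          _ = _ := by rw [hsdef]; ring
    refine ⟨2 * L, by positivity, fun i => (key i).trans ?_⟩
    have : 0 ≤ 2 * L * s ^ i := by positivity
    have e : ((m + 1 : ℕ) : ℝ) + a = p + 1 := by push_cast; ring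
    rw [e]; linarith

lemma pow_bern (m i : ℕ) : ((i : ℝ) + m) * (m : ℝ) ^ i ≤ m * ((m : ℝ) + 1) ^ i := by
  induction i with
  | zero => simp
  | succ i ih =>
    have h1 : (0 : ℝ) ≤ i * (m : ℝ) ^ i := by positivity
    calc _ = ((i : ℝ) + 1 + m) * m * (m : ℝ) ^ i := by push_cast; ring
      _ ≤ ((m : ℝ) + 1) * (((i : ℝ) + m) * (m : ℝ) ^ i) := by nlinarith
      _ ≤ ((m : ℝ) + 1) * (m * ((m : ℝ) + 1) ^ i) := by gcongr
      _ = _ := by ring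

lemma ind_step (a : ℕ) (b w : ℝ) (hb : 0 ≤ b) (hw : 0 ≤ w) (E : ℕ → ℕ → ℝ)
    (hz : ∀ m, E (m+1) 0 = 0)
    (hs : ∀ m i : ℕ, E (m+1) (i+1) = (m + 1 + a) * E (m+1) i + (i - m + b) * E m i
        - (i * (i - 1 + w) / 4) * E m (i-1))
    (K : ℝ) (hK : 2 ≤ K) (m : ℕ) (F : ℝ) (hF : 0 ≤ F)
    (hM : K ^ 2 * (1 + a) + (3 + b) / K + K * (1 + w) / 2 ≤ (m : ℝ))
    (ih : ∀ i, |E m i| ≤ F * ((m : ℝ) / K) ^ (2 * i)) (i : ℕ) :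
    |E (m+1) i| ≤ F * K ^ 3 * (((m + 1 : ℕ) : ℝ) / K) ^ (2 * i) := by
  have hK0 : 0 < K := by linarith
  set n : ℝ := (m : ℝ) + 1 with hn
  have hn1 : 1 ≤ n := by have : (0 : ℝ) ≤ m := by positivity
                         linarith
  have hcast : ((m + 1 : ℕ) : ℝ) = n := by push_cast; rfl
  rw [hcast]
  set r := (m / K) ^ 2 with hr
  set R := (n / K) ^ 2 with hR
  have hr0 : 0 ≤ r := by positivity
  have hR0 : 0 < R := by positivity
  have e1 : ∀ i, ((m : ℝ) / K) ^ (2 * i) = r ^ i := fun i => pow_mul _ _ _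
  have e2 : ∀ i, (n / K) ^ (2 * i) = R ^ i := fun i => pow_mul _ _ _
  rw [e2]
  simp only [e1] at ih
  have hrR : ∀ i, r ^ i ≤ R ^ i := by
    intro i
    rw [hr, hR, hn]; gcongr; linarith
  have f1 : ∀ j : ℕ, (j : ℝ) * (m / K) ^ j ≤ n * (n / K) ^ j := by
    intro j
    rw [div_pow, div_pow, ← mul_div_assoc, ← mul_div_assoc]
    gcongr ?_ / _
    calc (j : ℝ) * m ^ j ≤ ((j : ℝ) + m) * (m : ℝ) ^ j := by gcongr; linarith [(Nat.cast_nonneg m : (0 : ℝ) ≤ m)]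
      _ ≤ m * ((m : ℝ) + 1) ^ j := pow_bern m j
      _ ≤ n * n ^ j := by rw [hn]; gcongr; linarith
  have hmn : ∀ j : ℕ, ((m : ℝ) / K) ^ j ≤ (n / K) ^ j := by
    intro j; gcongr; linarith
  have rs : ∀ j : ℕ, r ^ j = (m / K) ^ j * (m / K) ^ j := by intro j; rw [hr]; ring
  have Rs : ∀ j : ℕ, R ^ j = (n / K) ^ j * (n / K) ^ j := by intro j; rw [hR]; ring
  have g1 : ∀ j : ℕ, (j : ℝ) * r ^ j ≤ n * R ^ j := by
    intro j
    rw [rs, Rs, ← mul_assoc, ← mul_assoc]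
    exact mul_le_mul (f1 j) (hmn j) (by positivity) (by positivity)
  have g2 : ∀ j : ℕ, (j : ℝ) ^ 2 * r ^ j ≤ n ^ 2 * R ^ j := by
    intro j
    calc _ = ((j : ℝ) * (m / K) ^ j) * ((j : ℝ) * (m / K) ^ j) := by rw [rs]; ring
      _ ≤ (n * (n / K) ^ j) * (n * (n / K) ^ j) := mul_le_mul (f1 j) (f1 j) (by positivity) (by positivity)
      _ = _ := by rw [Rs]; ring
  have num : (n + a) * K ^ 3 * R + (2 * n + b) * R + (n + 1) * (n + w) / 4 ≤ K ^ 3 * R * R := by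
    have hx : (n + 1) * (n + w) / 4 ≤ K ^ 2 * (1 + w) / 2 * R := by
      have : K ^ 2 * (1 + w) / 2 * R = (1 + w) / 2 * n ^ 2 := by rw [hR]; field_simp
      rw [this]
      have : 0 ≤ w * (n - 1) := mul_nonneg hw (by linarith)
      have : 0 ≤ w * (n - 1) * n := mul_nonneg this (by linarith)
      nlinarith
    have hy : (n + a) * K ^ 3 + (2 * n + b) + K ^ 2 * (1 + w) / 2 ≤ K ^ 3 * R := by
      have e : K ^ 3 * R = K * n * n := by rw [hR]; field_simp
      rw [e]
      have hM' : K * (K ^ 2 * (1 + a) + (3 + b) / K + K * (1 + w) / 2) ≤ K * n := by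
        gcongr; linarith
      have e' : K * (K ^ 2 * (1 + a) + (3 + b) / K + K * (1 + w) / 2)
        = K ^ 3 * (1 + a) + (3 + b) + K ^ 2 * (1 + w) / 2 := by field_simp
      rw [e'] at hM'
      have h1 := mul_le_mul_of_nonneg_right hM' (by linarith : 0 ≤ n)
      have h2 : 0 ≤ (n - 1) * (K ^ 3 * a) := mul_nonneg (by linarith) (by positivity)
      have h3 : 0 ≤ (n - 1) * b := mul_nonneg (by linarith) hb
      have h4 : 0 ≤ (n - 1) * (K ^ 2 * (1 + w) / 2) := mul_nonneg (by linarith) (by positivity)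
      nlinarith
    nlinarith [mul_le_mul_of_nonneg_right hy hR0.le]
  induction i with
  | zero => rw [hz]; simp; positivity
  | succ i ihi =>
    rw [hs]
    have t0 : |((m : ℝ) + 1 + a) * E (m+1) i| ≤ F * ((n + a) * K ^ 3 * R ^ i) := by
      rw [abs_mul, abs_of_nonneg (by positivity)]
      calc _ ≤ ((m : ℝ) + 1 + a) * (F * K ^ 3 * R ^ i) := by gcongr
        _ = _ := by rw [hn]; ring
    have t1 : |((i : ℝ) - m + b) * E m i| ≤ F * ((2 * n + b) * R ^ i) := by
      rw [abs_mul]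
      have : |(i : ℝ) - m + b| ≤ i + n + b := by
        have hi : (0 : ℝ) ≤ i := by positivity
        have hm : (0 : ℝ) ≤ m := by positivity
        rw [abs_le]; constructor <;> linarith
      calc _ ≤ (i + n + b) * (F * r ^ i) := by gcongr; exact ih i
        _ = F * (i * r ^ i + (n + b) * r ^ i) := by ring
        _ ≤ F * (n * R ^ i + (n + b) * R ^ i) := by
          apply mul_le_mul_of_nonneg_left _ hF
          exact add_le_add (g1 i) (mul_le_mul_of_nonneg_left (hrR i) (by positivity))
        _ = _ := by ring
    have t2 : |((i : ℝ) * (i - 1 + w) / 4) * E m (i-1)| * R ≤ F * ((n + 1) * (n + w) / 4 * R ^ i) := by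
      cases i with
      | zero => simp; positivity
      | succ j =>
        have hj : (0 : ℝ) ≤ j := by positivity
        rw [Nat.add_sub_cancel, abs_mul]
        push_cast
        rw [abs_of_nonneg (by apply div_nonneg (mul_nonneg (by positivity) (by linarith)); norm_num)]
        have hnn : 0 ≤ ((j : ℝ) + 1) * (j + 1 - 1 + w) / 4 := by
          apply div_nonneg (mul_nonneg (by positivity) (by linarith)); norm_num
        calc _ ≤ ((j : ℝ) + 1) * (j + 1 - 1 + w) / 4 * (F * r ^ j) * R := by gcongr; exact ih j
          _ = F * ((j ^ 2 * r ^ j + (1 + w) * (j * r ^ j) + w * r ^ j) / 4 * R) := by ring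
          _ ≤ F * ((n ^ 2 * R ^ j + (1 + w) * (n * R ^ j) + w * R ^ j) / 4 * R) := by
            apply mul_le_mul_of_nonneg_left _ hF
            apply mul_le_mul_of_nonneg_right _ hR0.le
            apply div_le_div_of_nonneg_right _ (by norm_num)
            exact add_le_add (add_le_add (g2 j) (mul_le_mul_of_nonneg_left (g1 j) (by positivity)))
              (mul_le_mul_of_nonneg_left (hrR j) hw)
          _ = _ := by ring
    have tot : |((m : ℝ) + 1 + a) * E (m+1) i + ((i : ℝ) - m + b) * E m i
        - ((i : ℝ) * (i - 1 + w) / 4) * E m (i-1)| ≤ |((m : ℝ) + 1 + a) * E (m+1) i| + |((i : ℝ) - m + b) * E m i|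
        + |((i : ℝ) * (i - 1 + w) / 4) * E m (i-1)| :=
      (abs_sub _ _).trans (add_le_add (abs_add_le _ _) le_rfl)
    refine tot.trans ?_
    refine le_of_mul_le_mul_right ?_ hR0
    have h1 := mul_le_mul_of_nonneg_right t0 hR0.le
    have h2 := mul_le_mul_of_nonneg_right t1 hR0.le
    have h3 := mul_le_mul_of_nonneg_left num (by positivity : 0 ≤ F * R ^ i)
    rw [pow_succ R]
    linarith

lemma main_bound (a : ℕ) (b w : ℝ) (hb : 0 ≤ b) (hw : 0 ≤ w) (E : ℕ → ℕ → ℝ)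
    (h00 : E 0 0 = 1) (h0 : ∀ i, E 0 (i+1) = a * E 0 i)
    (hz : ∀ m, E (m+1) 0 = 0)
    (hs : ∀ m i : ℕ, E (m+1) (i+1) = (m + 1 + a) * E (m+1) i + (i - m + b) * E m i
        - (i * (i - 1 + w) / 4) * E m (i-1))
    (K : ℝ) (hK : 2 ≤ K) :
    ∃ B : ℝ, 0 < B ∧ ∀ m : ℕ, K ^ 2 + a * K ≤ (m : ℝ) → ∀ i : ℕ,
      |E m i| ≤ B * K ^ (3 * m) * ((m : ℝ) / K) ^ (2 * i) := by
  have hK0 : 0 < K := by linarith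
  choose C hC hCb using base_bound a b w hb hw E h00 h0 hz hs
  obtain ⟨M, hM⟩ := exists_nat_ge (K ^ 2 * (1 + a) + (3 + b) / K + K * (1 + w) / 2)
  set B := 1 + ∑ k ∈ Finset.range (M + 1), C k with hB
  have hB0 : 0 < B := by
    have : 0 ≤ ∑ k ∈ Finset.range (M + 1), C k := Finset.sum_nonneg (fun k _ => hC k)
    linarith
  have hsmall : ∀ m : ℕ, m ≤ M → K ^ 2 + a * K ≤ (m : ℝ) → ∀ i : ℕ,
      |E m i| ≤ B * K ^ (3 * m) * ((m : ℝ) / K) ^ (2 * i) := by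
    intro m hm hmK i
    have hCB : C m ≤ B := by
      have : C m ≤ ∑ k ∈ Finset.range (M + 1), C k :=
        Finset.single_le_sum (f := C) (fun k _ => hC k) (Finset.mem_range.2 (by omega))
      linarith
    have hma : (m : ℝ) + a ≤ (m / K) ^ 2 := by
      rw [div_pow, le_div_iff₀ (by positivity)]
      have ha : (0 : ℝ) ≤ a := by positivity
      have h1 : K ≤ m := by nlinarith [mul_nonneg ha hK0.le]
      have h2 := mul_le_mul_of_nonneg_right hmK (by positivity : (0 : ℝ) ≤ m)
      have h3 : 0 ≤ a * K * (m - K) := mul_nonneg (by positivity) (by linarith)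
      nlinarith
    calc |E m i| ≤ C m * ((m : ℝ) + a) ^ i := hCb m i
      _ ≤ B * ((m / K) ^ 2) ^ i := by gcongr
      _ = B * 1 * (m / K) ^ (2 * i) := by rw [pow_mul]; ring
      _ ≤ _ := by gcongr; exact one_le_pow₀ (by linarith)
  have hMK : K ^ 2 + a * K ≤ (M : ℝ) := by
    have ha : (0 : ℝ) ≤ a := by positivity
    have : 0 ≤ a * K * (K - 1) := mul_nonneg (by positivity) (by linarith)
    have : 0 ≤ (3 + b) / K := by positivity
    have : 0 ≤ K * (1 + w) / 2 := by positivity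
    nlinarith
  have hlarge : ∀ m : ℕ, M ≤ m → ∀ i : ℕ,
      |E m i| ≤ B * K ^ (3 * m) * ((m : ℝ) / K) ^ (2 * i) := by
    intro m hm
    induction m, hm using Nat.le_induction with
    | base => exact hsmall M le_rfl hMK
    | succ m hm ih =>
      intro i
      have := ind_step a b w hb hw E hz hs K hK m (B * K ^ (3 * m)) (by positivity)
        (hM.trans (by exact_mod_cast hm)) ih i
      refine this.trans (le_of_eq ?_)
      congr 1
      ring
  refine ⟨B, hB0, fun m hm => ?_⟩
  rcases le_total m M with h | h
  · exact hsmall m h hm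
  · exact hlarge m h

/-- For every `K ≥ 2` there is `B > 0` such that for all `m ≥ K² + aK` and all `i ≥ 0`,
the `i`-th Taylor coefficient `e_{mi}` of `e m` at `v = 0` satisfies
`|e_{mi}| ≤ B K^{3m} (m/K)^{2i}`. -/
theorem e_coeff_uniform_bound
    (a b4 c4 : ℕ) (hw : 0 < 4 * a + b4 + c4)
    (e : ℕ → RatFunc ℚ)
    (herec : ∀ m : ℕ,
      e m / RatFunc.X - ((m : ℚ) + a) • e m
        + ((m : ℚ) - 1 - b4 / 4) • (if m = 0 then 0 else e (m - 1))
        - RatFunc.X * ratDeriv (if m = 0 then 0 else e (m - 1))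
        + (((2 * (a : ℚ) + b4 / 2 + c4 / 2) - 1) / 4) •
            (RatFunc.X * ratDeriv (RatFunc.X * (if m = 0 then 0 else e (m - 1))))
        + (1/4 : ℚ) • (RatFunc.X * ratDeriv (RatFunc.X *
            ratDeriv (RatFunc.X * (if m = 0 then 0 else e (m - 1)))))
      = (if m = 0 then 1 else 0) / RatFunc.X)
    (K : ℝ) (hK : 2 ≤ K) :
    ∃ B : ℝ, 0 < B ∧ ∀ m : ℕ, K ^ 2 + a * K ≤ (m : ℝ) → ∀ i : ℕ,
      |(((e m : LaurentSeries ℚ)).coeff (i : ℤ) : ℝ)|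
        ≤ B * K ^ (3 * m) * ((m : ℝ) / K) ^ (2 * i) := by
  obtain ⟨G, hG, h00, h0, hz, hs⟩ := bridge a b4 c4 e herec
  obtain ⟨B, hB, h⟩ := main_bound a (b4 / 4) (2 * (a : ℝ) + b4 / 2 + c4 / 2) (by positivity)
    (by positivity) (fun m i => ((PowerSeries.coeff i (G m) : ℚ) : ℝ))
    (by simp only [h00]; norm_num)
    (fun i => by simp only [h0]; push_cast; ring)
    (fun m => by simp only [hz]; norm_num)
    (fun m i => by simp only [hs]; push_cast; ring) K hK
  refine ⟨B, hB, fun m hm i => ?_⟩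
  have hc : (e m : LaurentSeries ℚ).coeff (i : ℤ) = PowerSeries.coeff i (G m) := by
    rw [phi_coe, hG, coeff_iot]
  rw [hc]
  exact h m hm i
end
end
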